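/- arXiv:2404.11460 — 4 statements merged into one kernel-verified Lean document; each statement's English description precedes it below -/
import Mathlib

section
/- Every convex quadrangle Q ⊆ ℝ² is n-self-affine for every integer n ≥ 5; that is, there exist invertible affine maps φ₁, …, φₙ : ℝ² → ℝ² such that Q = φ₁(Q) ∪ ⋯ ∪ φₙ(Q) and the interiors of the sets φᵢ(Q) are pairwise disjoint. -/
open Set

/-- A compact set `P ⊆ ℝ²` is `n`-self-affine if there are invertible affine maps
`φ₁, …, φₙ` such that `P = φ₁(P) ∪ ⋯ ∪ φₙ(P)` and the interiors of the `φᵢ(P)`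
are pairwise disjoint. -/
def IsSelfAffine (n : ℕ) (P : Set (ℝ × ℝ)) : Prop :=
  ∃ φ : Fin n → ((ℝ × ℝ) ≃ᵃ[ℝ] (ℝ × ℝ)),
    (⋃ i, φ i '' P) = P ∧
    Pairwise fun i j => Disjoint (interior (φ i '' P)) (interior (φ j '' P))

/-- A convex quadrangle is the convex hull of four points of `ℝ²`, none of which lies
in the convex hull of the other three. -/
def IsConvexQuadrangle (Q : Set (ℝ × ℝ)) : Prop :=
  ∃ a b c d : ℝ × ℝ,
    Q = convexHull ℝ {a, b, c, d} ∧
    a ∉ convexHull ℝ ({b, c, d} : Set (ℝ × ℝ)) ∧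
    b ∉ convexHull ℝ ({a, c, d} : Set (ℝ × ℝ)) ∧
    c ∉ convexHull ℝ ({a, b, d} : Set (ℝ × ℝ)) ∧
    d ∉ convexHull ℝ ({a, b, c} : Set (ℝ × ℝ))

def Tile (Q : Set (ℝ × ℝ)) (n : ℕ) (P : Set (ℝ × ℝ)) : Prop :=
  ∃ φ : Fin n → ((ℝ × ℝ) ≃ᵃ[ℝ] (ℝ × ℝ)),
    (⋃ i, φ i '' Q) = P ∧
    Pairwise fun i j => Disjoint (interior (φ i '' Q)) (interior (φ j '' Q))

lemma Tile.one (Q : Set (ℝ × ℝ)) (ψ : (ℝ × ℝ) ≃ᵃ[ℝ] (ℝ × ℝ)) : Tile Q 1 (ψ '' Q) := by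
  refine ⟨fun _ => ψ, iUnion_const _, ?_⟩
  intro i j h
  exact absurd (Subsingleton.elim i j) h

lemma Tile.add {Q P R : Set (ℝ × ℝ)} {n m : ℕ} (h1 : Tile Q n P) (h2 : Tile Q m R)
    (hd : Disjoint (interior P) (interior R)) : Tile Q (n + m) (P ∪ R) := by
  obtain ⟨φ, hφ, dφ⟩ := h1
  obtain ⟨ψ, hψ, dψ⟩ := h2
  have s1 : ∀ i, interior (φ i '' Q) ⊆ interior P := fun i =>
    interior_mono (hφ ▸ subset_iUnion (fun i => φ i '' Q) i)
  have s2 : ∀ i, interior (ψ i '' Q) ⊆ interior R := fun i =>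
    interior_mono (hψ ▸ subset_iUnion (fun i => ψ i '' Q) i)
  refine ⟨Fin.append φ ψ, ?_, ?_⟩
  · rw [← hφ, ← hψ]
    apply subset_antisymm
    · refine iUnion_subset fun i => ?_
      refine Fin.addCases (fun i => ?_) (fun i => ?_) i
      · rw [Fin.append_left]
        exact (subset_iUnion (fun i => φ i '' Q) i).trans subset_union_left
      · rw [Fin.append_right]
        exact (subset_iUnion (fun i => ψ i '' Q) i).trans subset_union_right
    · refine union_subset (iUnion_subset fun i => ?_) (iUnion_subset fun i => ?_)
      · have := subset_iUnion (fun i =>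
          (Fin.append φ ψ : Fin (n + m) → ((ℝ × ℝ) ≃ᵃ[ℝ] (ℝ × ℝ))) i '' Q) (Fin.castAdd m i)
        simpa only [Fin.append_left] using this
      · have := subset_iUnion (fun i =>
          (Fin.append φ ψ : Fin (n + m) → ((ℝ × ℝ) ≃ᵃ[ℝ] (ℝ × ℝ))) i '' Q) (Fin.natAdd n i)
        simpa only [Fin.append_right] using this
  · intro i j
    refine Fin.addCases (fun i => ?_) (fun i => ?_) i <;>
    refine Fin.addCases (fun j => ?_) (fun j => ?_) j <;> intro hij <;>
    simp only [Fin.append_left, Fin.append_right]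
    · exact dφ (fun h => hij (by rw [h]))
    · exact hd.mono (s1 i) (s2 j)
    · exact (hd.mono (s1 j) (s2 i)).symm
    · exact dψ (fun h => hij (by rw [h]))

lemma interior_image (ψ : (ℝ × ℝ) ≃ᵃ[ℝ] (ℝ × ℝ)) (P : Set (ℝ × ℝ)) :
    interior (ψ '' P) = ψ '' interior P := by
  exact ((AffineEquiv.toContinuousAffineEquiv ψ).toHomeomorph.image_interior P).symm

lemma Tile.image {Q P : Set (ℝ × ℝ)} {n : ℕ} (h : Tile Q n P)
    (ψ : (ℝ × ℝ) ≃ᵃ[ℝ] (ℝ × ℝ)) : Tile Q n (ψ '' P) := by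
  obtain ⟨φ, hφ, dφ⟩ := h
  have e : ∀ i, ((φ i).trans ψ) '' Q = ψ '' (φ i '' Q) := fun i => by
    rw [← image_comp]; rfl
  refine ⟨fun i => (φ i).trans ψ, ?_, ?_⟩
  · simp only [e]
    rw [← image_iUnion, hφ]
  · intro i j hij
    simp only [e, interior_image]
    exact (disjoint_image_iff ψ.injective).2 (by simpa [interior_image] using dφ hij)

/-- Changing the prototile by an affine equivalence. -/
lemma Tile.base {Q P : Set (ℝ × ℝ)} {n : ℕ} (ψ : (ℝ × ℝ) ≃ᵃ[ℝ] (ℝ × ℝ))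
    (h : Tile Q n P) : Tile (ψ '' Q) n P := by
  obtain ⟨φ, hφ, dφ⟩ := h
  have e : ∀ i, (ψ.symm.trans (φ i)) '' (ψ '' Q) = φ i '' Q := fun i => by
    rw [← image_comp]; congr 1; ext x <;> simp
  refine ⟨fun i => ψ.symm.trans (φ i), ?_, ?_⟩
  · simp only [e, hφ]
  · intro i j hij
    simp only [e]
    exact dφ hij

lemma selfAffine_image {Q : Set (ℝ × ℝ)} {n : ℕ} (ψ : (ℝ × ℝ) ≃ᵃ[ℝ] (ℝ × ℝ))
    (h : IsSelfAffine n Q) : IsSelfAffine n (ψ '' Q) :=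
  Tile.base ψ (Tile.image (h : Tile Q n Q) ψ)

/-- The affine equivalence with given origin and linear frame. -/
noncomputable def aff (o e f : ℝ × ℝ) (h : e.1 * f.2 - e.2 * f.1 ≠ 0) :
    (ℝ × ℝ) ≃ᵃ[ℝ] (ℝ × ℝ) :=
  (LinearEquiv.toAffineEquiv
    { toFun := fun z => (z.1 * e.1 + z.2 * f.1, z.1 * e.2 + z.2 * f.2)
      map_add' := by intro a b; ext <;> simp <;> ring
      map_smul' := by intro a b; ext <;> simp <;> ring
      invFun := fun w => ((w.1 * f.2 - w.2 * f.1) / (e.1 * f.2 - e.2 * f.1),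
        (e.1 * w.2 - e.2 * w.1) / (e.1 * f.2 - e.2 * f.1))
      left_inv := by
        intro z
        ext
        · simp only; rw [div_eq_iff h]; ring
        · simp only; rw [div_eq_iff h]; ring
      right_inv := by
        intro z
        ext
        · simp only; rw [div_mul_eq_mul_div, div_mul_eq_mul_div, ← add_div, div_eq_iff h]; ring
        · simp only; rw [div_mul_eq_mul_div, div_mul_eq_mul_div, ← add_div, div_eq_iff h]; ring
      }).trans (AffineEquiv.constVAdd ℝ (ℝ × ℝ) o)

lemma aff_apply (o e f : ℝ × ℝ) (h) (z : ℝ × ℝ) :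
    aff o e f h z = (o.1 + (z.1 * e.1 + z.2 * f.1), o.2 + (z.1 * e.2 + z.2 * f.2)) := by
  simp [aff]
  rfl

lemma sep {P R : Set (ℝ × ℝ)} (α β k : ℝ) (h : 0 < α ^ 2 + β ^ 2)
    (hP : ∀ z ∈ P, α * z.1 + β * z.2 ≤ k) (hR : ∀ z ∈ R, k ≤ α * z.1 + β * z.2) :
    Disjoint (interior P) (interior R) := by
  rw [Set.disjoint_left]
  intro z hz hz'
  have ho : IsOpen (interior P ∩ interior R) := isOpen_interior.inter isOpen_interior
  have hc : Continuous fun t : ℝ => ((z.1 + t * α, z.2 + t * β) : ℝ × ℝ) := by fun_prop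
  have h1 := (ho.preimage hc).mem_nhds (x := 0) (by simpa using ⟨hz, hz'⟩)
  obtain ⟨δ, hδ, hb⟩ := Metric.mem_nhds_iff.1 h1
  have h2 : δ / 2 ∈ Metric.ball (0 : ℝ) δ := by
    rw [Metric.mem_ball, dist_zero_right, Real.norm_eq_abs, abs_of_pos (by linarith)]; linarith
  have h3 := hP _ (interior_subset (hb h2).1)
  have h4 := hR _ (interior_subset hz')
  simp only at h3
  nlinarith [mul_pos hδ h]

lemma hull_le {a b c d : ℝ × ℝ} (α β k : ℝ) (ha : α * a.1 + β * a.2 ≤ k)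
    (hb : α * b.1 + β * b.2 ≤ k) (hc : α * c.1 + β * c.2 ≤ k) (hd : α * d.1 + β * d.2 ≤ k) :
    ∀ z ∈ convexHull ℝ ({a, b, c, d} : Set (ℝ × ℝ)), α * z.1 + β * z.2 ≤ k := by
  have hconv : Convex ℝ {z : ℝ × ℝ | α * z.1 + β * z.2 ≤ k} := by
    intro x hx y hy s t hs ht hst
    simp only [mem_ofPred_eq, Prod.fst_add, Prod.snd_add, Prod.smul_fst, Prod.smul_snd,
      smul_eq_mul] at *
    have : k = s * k + t * k := by rw [← add_mul, hst, one_mul]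
    nlinarith [mul_le_mul_of_nonneg_left hx hs, mul_le_mul_of_nonneg_left hy ht]
  intro z hz
  refine convexHull_min ?_ hconv hz
  intro w hw
  simp only [mem_insert_iff, mem_singleton_iff] at hw
  rcases hw with rfl | rfl | rfl | rfl <;> assumption

lemma hull_ge {a b c d : ℝ × ℝ} (α β k : ℝ) (ha : k ≤ α * a.1 + β * a.2)
    (hb : k ≤ α * b.1 + β * b.2) (hc : k ≤ α * c.1 + β * c.2) (hd : k ≤ α * d.1 + β * d.2) :
    ∀ z ∈ convexHull ℝ ({a, b, c, d} : Set (ℝ × ℝ)), k ≤ α * z.1 + β * z.2 := by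
  intro z hz
  have := hull_le (-α) (-β) (-k) (a := a) (b := b) (c := c) (d := d) (by linarith) (by linarith)
    (by linarith) (by linarith) z hz
  linarith

def cr (a b p : ℝ × ℝ) : ℝ := (b.1 - a.1) * (p.2 - a.2) - (b.2 - a.2) * (p.1 - a.1)

lemma tri_mem {S : Set (ℝ × ℝ)} (hS : Convex ℝ S) {a b c p : ℝ × ℝ} (ha : a ∈ S) (hb : b ∈ S)
    (hc : c ∈ S) (h : 0 < cr a b c) (h1 : 0 ≤ cr a b p) (h2 : 0 ≤ cr b c p) (h3 : 0 ≤ cr c a p) :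
    p ∈ S := by
  have key := hS.sum_mem (t := Finset.univ) (w := ![cr b c p / cr a b c, cr c a p / cr a b c,
    cr a b p / cr a b c]) (z := ![a, b, c]) ?_ ?_ ?_
  · simp only [Fin.sum_univ_three, Matrix.cons_val_zero, Matrix.cons_val_one, Matrix.cons_val] at key
    convert key using 1
    have h' := h.ne'
    ext
    · simp only [Prod.fst_add, Prod.smul_fst, smul_eq_mul]
      rw [div_mul_eq_mul_div, div_mul_eq_mul_div, div_mul_eq_mul_div, ← add_div, ← add_div,
        eq_div_iff h']
      simp only [cr]; ring
    · simp only [Prod.snd_add, Prod.smul_snd, smul_eq_mul]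
      rw [div_mul_eq_mul_div, div_mul_eq_mul_div, div_mul_eq_mul_div, ← add_div, ← add_div,
        eq_div_iff h']
      simp only [cr]; ring
  · intro i _
    fin_cases i <;> simp <;> positivity
  · simp only [Fin.sum_univ_three, Matrix.cons_val_zero, Matrix.cons_val_one, Matrix.cons_val]
    rw [← add_div, ← add_div, div_eq_iff h.ne']
    simp only [cr]; ring
  · intro i _
    fin_cases i <;> simp <;> assumption

lemma hull_mem {a b c d p : ℝ × ℝ} (h : 0 < cr a b c) (h' : 0 < cr a c d)
    (h1 : 0 ≤ cr a b p) (h2 : 0 ≤ cr b c p) (h3 : 0 ≤ cr c d p) (h4 : 0 ≤ cr d a p) :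
    p ∈ convexHull ℝ ({a, b, c, d} : Set (ℝ × ℝ)) := by
  have hc := convex_convexHull ℝ ({a, b, c, d} : Set (ℝ × ℝ))
  have hs := subset_convexHull ℝ ({a, b, c, d} : Set (ℝ × ℝ))
  rcases le_total (cr a c p) 0 with hp | hp
  · refine tri_mem hc (hs (by simp)) (hs (by simp)) (hs (by simp)) h h1 h2 ?_
    have : cr c a p = - cr a c p := by simp only [cr]; ring
    linarith
  · exact tri_mem hc (hs (by simp)) (hs (by simp)) (hs (by simp)) h' hp h3 h4

lemma aff_hull (o e f : ℝ × ℝ) (h) (a b c d : ℝ × ℝ) :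
    aff o e f h '' convexHull ℝ {a, b, c, d} = convexHull ℝ {aff o e f h a, aff o e f h b,
      aff o e f h c, aff o e f h d} := by
  have := AffineMap.image_convexHull (aff o e f h).toAffineMap ({a, b, c, d} : Set (ℝ × ℝ))
  rw [AffineEquiv.coe_toAffineMap] at this
  rw [this]
  simp only [image_insert_eq, image_singleton]

/-- Standard trapezoid. -/
def Trap (κ : ℝ) : Set (ℝ × ℝ) := {z | 0 ≤ z.1 ∧ 0 ≤ z.2 ∧ κ ≤ z.1 + z.2 ∧ z.1 + z.2 ≤ 1}

lemma trap_hull {κ : ℝ} (h0 : 0 < κ) (h1 : κ < 1) :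
    Trap κ = convexHull ℝ {((1 : ℝ), (0 : ℝ)), (0, 1), (0, κ), (κ, 0)} := by
  apply subset_antisymm
  · rintro ⟨u, v⟩ ⟨hu, hv, h2, h3⟩
    simp only at hu hv h2 h3
    apply hull_mem <;> simp only [cr] <;> nlinarith
  · intro z hz
    refine ⟨?_, ?_, ?_, ?_⟩
    · have := hull_ge 1 0 0 (by norm_num) (by norm_num) (by norm_num) (by simp; linarith) z hz
      linarith
    · have := hull_ge 0 1 0 (by norm_num) (by norm_num) (by simp; linarith) (by norm_num) z hz
      linarith
    · have := hull_ge 1 1 κ (by simp; linarith) (by simp; linarith) (by simp) (by simp) z hz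
      linarith
    · have := hull_le 1 1 1 (by simp) (by simp) (by simp; linarith) (by simp; linarith) z hz
      linarith

/-- An arbitrary trapezoid as affine image of the standard one. -/
lemma trap_tile {Q : Set (ℝ × ℝ)} {n : ℕ} {κ : ℝ} (h0 : 0 < κ) (h1 : κ < 1)
    (h : Tile Q n (Trap κ)) {a b c d : ℝ × ℝ} (h2 : c.1 - d.1 = κ * (b.1 - a.1))
    (h3 : c.2 - d.2 = κ * (b.2 - a.2)) (h4 : cr a d b ≠ 0) :
    Tile Q n (convexHull ℝ {a, b, c, d}) := by
  have h5 : 1 - κ ≠ 0 := by linarith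
  set e : ℝ × ℝ := ((a.1 - d.1) / (1 - κ), (a.2 - d.2) / (1 - κ)) with he
  have e1 : e.1 * (1 - κ) = a.1 - d.1 := div_mul_cancel₀ _ h5
  have e2 : e.2 * (1 - κ) = a.2 - d.2 := div_mul_cancel₀ _ h5
  clear_value e
  have hne : e.1 * (b.2 - (a.2 - e.2)) - e.2 * (b.1 - (a.1 - e.1)) ≠ 0 := by
    intro h6
    apply h4
    simp only [cr]
    linear_combination (-(1 - κ)) * h6 + (b.2 - a.2) * e1 - (b.1 - a.1) * e2
  have := h.image (aff (a.1 - e.1, a.2 - e.2) e (b.1 - (a.1 - e.1), b.2 - (a.2 - e.2)) hne)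
  rw [trap_hull h0 h1, aff_hull] at this
  convert this using 3
  · ext <;> simp [aff_apply]
  congr 1
  · ext <;> simp [aff_apply]
  congr 1
  · ext
    · simp [aff_apply]; linear_combination h2 + e1
    · simp [aff_apply]; linear_combination h3 + e2
  · congr 1
    ext
    · simp [aff_apply]; linear_combination e1
    · simp [aff_apply]; linear_combination e2

lemma trap_split {κ : ℝ} (h0 : 0 < κ) {Q : Set (ℝ × ℝ)} {n m : ℕ} (h : Tile Q n (Trap κ))
    (h' : Tile Q m (Trap κ)) : Tile Q (n + m) (Trap κ) := by
  have i1 := h.image (aff (0, 0) (1, 0) (1 / 2, 1 / 2) (by norm_num))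
  have i2 := h'.image (aff (0, 0) (1 / 2, 1 / 2) (0, 1) (by norm_num))
  have q1 : ∀ z ∈ (aff (0, 0) (1, 0) (1 / 2, 1 / 2) (by norm_num)) '' Trap κ,
      (-1) * z.1 + 1 * z.2 ≤ 0 := by
    rintro _ ⟨z, ⟨hu, hv, h2, h3⟩, rfl⟩
    simp only [aff_apply]; linarith
  have q2 : ∀ z ∈ (aff (0, 0) (1 / 2, 1 / 2) (0, 1) (by norm_num)) '' Trap κ,
      0 ≤ (-1) * z.1 + 1 * z.2 := by
    rintro _ ⟨z, ⟨hu, hv, h2, h3⟩, rfl⟩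
    simp only [aff_apply]; linarith
  have := i1.add i2 (sep (-1) 1 0 (by norm_num) q1 q2)
  convert this using 1
  apply subset_antisymm
  · rintro ⟨u, v⟩ ⟨hu, hv, h2, h3⟩
    simp only at hu hv h2 h3
    rcases le_total v u with hvu | hvu
    · left
      refine ⟨(u - v, 2 * v), ⟨by simp; linarith, by simp; linarith, by simp; linarith,
        by simp; linarith⟩, ?_⟩
      ext <;> simp only [aff_apply] <;> ring
    · right
      refine ⟨(2 * u, v - u), ⟨by simp; linarith, by simp; linarith, by simp; linarith,
        by simp; linarith⟩, ?_⟩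
      ext <;> simp only [aff_apply] <;> ring
  · refine union_subset ?_ ?_ <;> rintro _ ⟨z, ⟨hu, hv, h2, h3⟩, rfl⟩ <;>
    refine ⟨?_, ?_, ?_, ?_⟩ <;> simp only [aff_apply] <;> linarith

lemma trap_even {κ : ℝ} (h0 : 0 < κ) {Q : Set (ℝ × ℝ)} (h : Tile Q 2 (Trap κ)) (m : ℕ) :
    Tile Q (2 * (m + 1)) (Trap κ) := by
  induction m with
  | zero => exact h
  | succ k ih => exact trap_split h0 ih h

lemma hull_closed (a b c d : ℝ × ℝ) : IsClosed (convexHull ℝ ({a, b, c, d} : Set (ℝ × ℝ))) :=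
  (Set.Finite.isCompact_convexHull (𝕜 := ℝ) (Set.toFinite _)).isClosed

lemma disj_union {P R S : Set (ℝ × ℝ)} (hP : IsClosed P) (h1 : Disjoint (interior P) (interior S))
    (h2 : Disjoint (interior R) (interior S)) : Disjoint (interior (P ∪ R)) (interior S) := by
  rw [Set.disjoint_left] at *
  intro z hz hz'
  have hU : IsOpen (interior (P ∪ R) ∩ interior S) := isOpen_interior.inter isOpen_interior
  by_cases h : interior (P ∪ R) ∩ interior S ⊆ P
  · exact h1 (mem_interior.2 ⟨_, h, hU, hz, hz'⟩) hz'
  · obtain ⟨t, ht, htP⟩ := Set.not_subset.1 h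
    refine h2 (a := t) (mem_interior.2 ⟨(interior (P ∪ R) ∩ interior S) ∩ Pᶜ, ?_,
      hU.inter hP.isOpen_compl, ht, htP⟩) ht.2
    rintro r ⟨⟨hr, _⟩, hrP⟩
    exact (interior_subset hr).resolve_left hrP

lemma hull_sub {a b c d : ℝ × ℝ} {S : Set (ℝ × ℝ)} (hS : Convex ℝ S) (ha : a ∈ S) (hb : b ∈ S)
    (hc : c ∈ S) (hd : d ∈ S) : convexHull ℝ ({a, b, c, d} : Set (ℝ × ℝ)) ⊆ S := by
  refine convexHull_min ?_ hS
  intro w hw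
  simp only [mem_insert_iff, mem_singleton_iff] at hw
  rcases hw with rfl | rfl | rfl | rfl <;> assumption

lemma hull_rev (a b c d : ℝ × ℝ) : convexHull ℝ ({a, b, c, d} : Set (ℝ × ℝ)) =
    convexHull ℝ ({d, c, b, a} : Set (ℝ × ℝ)) := by
  congr 1
  ext z
  simp only [mem_insert_iff, mem_singleton_iff]
  tauto

/-- Normal form of a convex quadrangle. -/
def S (x y : ℝ) : Set (ℝ × ℝ) := convexHull ℝ {((0 : ℝ), (0 : ℝ)), (1, 0), (x, y), (0, 1)}

lemma S_mem {x y : ℝ} (hx : 0 < x) (hy : 0 < y) {p : ℝ × ℝ} (h1 : 0 ≤ p.1)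
    (h2 : 0 ≤ p.2) (h3 : y * p.1 + (1 - x) * p.2 ≤ y) (h4 : (1 - y) * p.1 + x * p.2 ≤ x) :
    p ∈ S x y := by
  apply hull_mem <;> simp only [cr] <;> nlinarith

lemma S_ineq {x y : ℝ} (hx : 0 < x) (hy : 0 < y) (hxy : 1 < x + y) {p : ℝ × ℝ}
    (hp : p ∈ S x y) : 0 ≤ p.1 ∧ 0 ≤ p.2 ∧ y * p.1 + (1 - x) * p.2 ≤ y ∧
      (1 - y) * p.1 + x * p.2 ≤ x := by
  refine ⟨?_, ?_, ?_, ?_⟩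
  · have := hull_ge 1 0 0 (by simp) (by simp) (by simp; linarith) (by simp) p hp
    linarith
  · have := hull_ge 0 1 0 (by simp) (by simp) (by simp; linarith) (by simp) p hp
    linarith
  · exact hull_le y (1 - x) y (by simp; linarith) (by simp) (by simp; linarith)
      (by simp; linarith) p hp
  · exact hull_le (1 - y) x x (by simp; linarith) (by simp; linarith) (by simp; linarith)
      (by simp) p hp

lemma two_tile {p q : ℝ} (hp : 0 < p) (hp1 : p < 1) (hq : 0 < q) (hq1 : q < 1) :
    Tile (convexHull ℝ {((0 : ℝ), (1 : ℝ)), (0, q), (p, 0), (1, 0)}) 2 (Trap (p * q)) := by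
  set K := convexHull ℝ {((0 : ℝ), (1 : ℝ)), (0, q), (p, 0), (1, 0)} with hK
  have hpq : 0 < p * q := mul_pos hp hq
  have hpq1 : p * q < p := by nlinarith
  have hpq2 : p * q < q := by nlinarith
  have t1 : Tile K 1 K := by
    have := Tile.one K (AffineEquiv.refl ℝ _)
    simpa using this
  have t2 := Tile.one K (aff (0, 0) (0, q) (p, 0) (by simp; exact ⟨hq.ne', hp.ne'⟩))
  have e2 : aff (0, 0) (0, q) (p, 0) (by simp; exact ⟨hq.ne', hp.ne'⟩) '' K
      = convexHull ℝ {(p, 0), (0, q), (0, p * q), (p * q, 0)} := by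
    rw [hK, aff_hull]
    simp only [aff_apply]
    congr 1
    ext z
    simp only [mem_insert_iff, mem_singleton_iff, mul_comm q p]
    simp
    tauto
  rw [e2] at t2
  have hd := t1.add t2 (sep (-q) (-p) (-(p * q)) (by nlinarith)
    (hull_le _ _ _ (by simp; linarith) (by simp) (by simp; linarith) (by simp; linarith))
    (hull_ge _ _ _ (by simp; linarith) (by simp) (by simp; nlinarith) (by simp; nlinarith)))
  convert hd using 1
  apply subset_antisymm
  · rintro ⟨u, v⟩ ⟨hu, hv, h2, h3⟩
    simp only at hu hv h2 h3
    rcases le_total (p * q) (q * u + p * v) with h | h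
    · left
      apply hull_mem <;> simp only [cr] <;> nlinarith
    · right
      apply hull_mem <;> simp only [cr] <;> nlinarith [mul_pos hpq hpq]
  · have hconv : Convex ℝ (Trap (p * q)) := by
      rw [trap_hull hpq (by linarith)]; exact convex_convexHull _ _
    refine union_subset (hull_sub hconv ?_ ?_ ?_ ?_) (hull_sub hconv ?_ ?_ ?_ ?_) <;>
    refine ⟨?_, ?_, ?_, ?_⟩ <;> simp only <;> linarith

lemma S_two_tile {x y : ℝ} (hx : 0 < x) (hy : 0 < y) (hy1 : y < 1) (hxy : 1 < x + y) :
    Tile (S x y) 2 (Trap (y * ((x + y - 1) / x))) := by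
  set q := (x + y - 1) / x with hq
  have hq0 : 0 < q := div_pos (by linarith) hx
  have hq1 : q < 1 := by rw [hq, div_lt_one hx]; linarith
  have hqx : q * x = x + y - 1 := div_mul_cancel₀ _ hx.ne'
  clear_value q
  have t := two_tile hy hy1 hq0 hq1
  have hne2 : (0 : ℝ) * (-1) - (q - 1) * 1 ≠ 0 := by
    have : 1 - q ≠ 0 := by linarith
    intro h; apply this; linarith
  have e : aff (0, 1) (0, q - 1) (1, -1) hne2 '' S x y =
      convexHull ℝ {((0 : ℝ), (1 : ℝ)), (0, q), (y, 0), (1, 0)} := by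
    rw [S, aff_hull]
    simp only [aff_apply]
    have : (1 : ℝ) + (x * (q - 1) + y * -1) = 0 := by linarith
    rw [this]
    simp
  have t' := t.base (aff (0, 1) (0, q - 1) (1, -1) hne2).symm
  rw [← e] at t'
  convert t' using 1
  rw [← image_comp]
  ext z
  simp

lemma S_scale (x y : ℝ) {l : ℝ} (hl : 0 < l) :
    Tile (S x y) 1 (convexHull ℝ {((0 : ℝ), (0 : ℝ)), (l, 0), (l * x, l * y), (0, l)}) := by
  have hne : l * l - 0 * 0 ≠ 0 := by nlinarith
  have := Tile.one (S x y) (aff (0, 0) (l, 0) (0, l) hne)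
  convert this using 1
  rw [S, aff_hull]
  simp [aff_apply, mul_comm]

lemma odd_step {x y k : ℝ} (hx : 0 < x) (hy : 0 < y) (hxy : 1 < x + y) (hk : 0 < k) (hk1 : k < 1)
    {a b : ℕ} (ha : Tile (S x y) a (Trap k)) (hb : Tile (S x y) b (Trap k)) :
    Tile (S x y) (1 + a + b) (S x y) := by
  have hkx := mul_pos hk hx
  have hky := mul_pos hk hy
  have hxy' := mul_pos hx hy
  have t0 := S_scale x y hk
  have t1 := trap_tile hk hk1 ha (a := (1, 0)) (b := (x, y)) (c := (k * x, k * y)) (d := (k, 0))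
    (by simp; ring) (by simp) (by simp [cr]; exact ⟨by linarith, hy.ne'⟩)
  have t2 := trap_tile hk hk1 hb (a := (0, 1)) (b := (x, y)) (c := (k * x, k * y)) (d := (0, k))
    (by simp) (by simp; ring) (by simp [cr]; exact ⟨by linarith, hx.ne'⟩)
  have d01 := sep y (1 - x) (k * y) (by positivity)
    (hull_le (a := (0, 0)) (b := (k, 0)) (c := (k * x, k * y)) (d := (0, k)) y (1 - x) (k * y)
      (by simp; linarith) (by simp; linarith) (by simp; linarith) (by simp; nlinarith))
    (hull_ge (a := (1, 0)) (b := (x, y)) (c := (k * x, k * y)) (d := (k, 0)) y (1 - x) (k * y)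
      (by simp; nlinarith) (by simp; nlinarith) (by simp; linarith) (by simp; linarith))
  have d02 := sep (1 - y) x (k * x) (by positivity)
    (hull_le (a := (0, 0)) (b := (k, 0)) (c := (k * x, k * y)) (d := (0, k)) (1 - y) x (k * x)
      (by simp; linarith) (by simp; nlinarith) (by simp; linarith) (by simp; linarith))
    (hull_ge (a := (0, 1)) (b := (x, y)) (c := (k * x, k * y)) (d := (0, k)) (1 - y) x (k * x)
      (by simp; nlinarith) (by simp; nlinarith) (by simp; linarith) (by simp; linarith))
  have d12 := sep (-y) x 0 (by positivity)
    (hull_le (a := (1, 0)) (b := (x, y)) (c := (k * x, k * y)) (d := (k, 0)) (-y) x 0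
      (by simp; linarith) (by simp; linarith) (by simp; linarith) (by simp; nlinarith))
    (hull_ge (a := (0, 1)) (b := (x, y)) (c := (k * x, k * y)) (d := (0, k)) (-y) x 0
      (by simp; linarith) (by simp; linarith) (by simp; linarith) (by simp; nlinarith))
  have := (t0.add t1 d01).add t2 (disj_union (hull_closed _ _ _ _) d02 d12)
  convert this using 1
  apply subset_antisymm
  · rintro ⟨u, v⟩ hp
    obtain ⟨h1, h2, h3, h4⟩ := S_ineq hx hy hxy hp
    simp only at h1 h2 h3 h4
    have hm : y * ((1 - y) * u + x * v) = x * (y * u + (1 - x) * v)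
      + (x + y - 1) * (x * v - y * u) := by ring
    have hw : 0 < x + y - 1 := by linarith
    by_cases h0 : y * u + (1 - x) * v ≤ k * y ∧ (1 - y) * u + x * v ≤ k * x
    · left; left
      apply hull_mem <;> simp only [cr] <;> nlinarith
    rcases le_total (x * v - y * u) 0 with hd | hd
    · left; right
      have hf : k * y ≤ y * u + (1 - x) * v := by
        by_contra hf
        push Not at hf
        exact h0 ⟨hf.le, by nlinarith⟩
      apply hull_mem <;> simp only [cr] <;> nlinarith
    · right
      have hf : k * x ≤ (1 - y) * u + x * v := by
        by_contra hf
        push Not at hf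
        exact h0 ⟨by nlinarith, hf.le⟩
      rw [hull_rev]
      apply hull_mem <;> simp only [cr] <;> nlinarith
  · have hconv : Convex ℝ (S x y) := convex_convexHull _ _
    refine union_subset (union_subset (hull_sub hconv ?_ ?_ ?_ ?_) (hull_sub hconv ?_ ?_ ?_ ?_))
      (hull_sub hconv ?_ ?_ ?_ ?_) <;>
    apply S_mem hx hy <;> simp only <;> nlinarith

lemma cover_aux {x y w f g L M : ℝ} (hx : 0 < x) (hy : 0 < y) (hw : 0 < w)
    (e1 : ((1 - w) * y - 1 + x) * g = - (x * w) * f + w * M)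
    (e2 : - w ^ 2 * f = ((1 - w) * y - 1 + x) * L - w * y * M)
    (h1 : 0 ≤ f) (h2 : 0 < L) (h3 : M < 0) (h4 : g < 0) : False := by
  have a1 : 0 ≤ x * w * f := by positivity
  have a2 : w * M < 0 := mul_neg_of_pos_of_neg hw h3
  have a3 : w * y * M < 0 := mul_neg_of_pos_of_neg (by positivity) h3
  have a4 : 0 ≤ w ^ 2 * f := by positivity
  rcases le_total ((1 - w) * y - 1 + x) 0 with h | h
  · have := mul_nonneg_of_nonpos_of_nonpos h h4.le
    linarith
  · have := mul_nonneg h h2.le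
    linarith

set_option maxHeartbeats 2000000 in
lemma even_step {x y k : ℝ} (hx : 0 < x) (hy : 0 < y) (hxy : 1 < x + y) (hxy2 : x + y < 2)
    (hk : 0 < k) (hk1 : k < 1)
    {a b : ℕ} (ha : Tile (S x y) a (Trap k)) (hb : Tile (S x y) b (Trap k)) :
    Tile (S x y) (1 + a + b + 1) (S x y) := by
  obtain ⟨w, hw⟩ : ∃ w, w = x + y - 1 := ⟨_, rfl⟩
  have hw0 : 0 < w := by linarith
  have hw1 : w < 1 := by linarith
  have hkw : k * w < 1 := by nlinarith
  obtain ⟨e, he⟩ : ∃ e, e = (1 - k) / (1 - k * w) := ⟨_, rfl⟩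
  have he0 : 0 < e := by rw [he]; exact div_pos (by linarith) (by linarith)
  have he1 : e < 1 := by rw [he, div_lt_one (by linarith)]; nlinarith
  have hek : 1 - e = k * (1 - e * w) := by
    have : e * (1 - k * w) = 1 - k := by rw [he]; exact div_mul_cancel₀ _ (by linarith)
    linarith
  clear he
  obtain ⟨l, hl⟩ : ∃ l, l = 1 - e * w := ⟨_, rfl⟩
  rw [← hl] at hek
  have hew : 0 < e * w := mul_pos he0 hw0
  have hewe : e * w < w := by nlinarith
  have heww : e * w < e := by nlinarith
  have hl0 : 0 < l := by linarith
  have hl1 : l < 1 := by linarith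
  have hlx := mul_pos hl0 hx
  have hly := mul_pos hl0 hy
  have t0 := S_scale x y hl0
  have t1 := trap_tile hk hk1 ha (a := (l, 0)) (b := (l * x, l * y))
    (c := (x + e * (1 - x), (1 - e) * y)) (d := (1, 0))
    (by simp only; linear_combination (x - 1) * hek) (by simp only; linear_combination y * hek)
    (by simp [cr]; exact ⟨by linarith, hl0.ne', hy.ne'⟩)
  have t2 := trap_tile hk hk1 hb (a := (0, l)) (b := (l * x, l * y))
    (c := ((1 - e) * x, y + e * (1 - y))) (d := (0, 1))
    (by simp only; linear_combination x * hek) (by simp only; linear_combination (y - 1) * hek)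
    (by simp [cr]; exact ⟨by linarith, hl0.ne', hx.ne'⟩)
  have hne : (e * (1 - x)) * (e * (1 - y)) - (e * -y) * (e * -x) ≠ 0 := by
    have : (e * (1 - x)) * (e * (1 - y)) - (e * -y) * (e * -x) = - (e ^ 2 * w) := by rw [hw]; ring
    rw [this]
    have : 0 < e ^ 2 * w := by positivity
    linarith
  have t3 := Tile.one (S x y) (aff (x, y) (e * (1 - x), e * -y) (e * -x, e * (1 - y)) hne)
  have e3 : aff (x, y) (e * (1 - x), e * -y) (e * -x, e * (1 - y)) hne '' S x y =
      convexHull ℝ {(x, y), (x + e * (1 - x), (1 - e) * y), (l * x, l * y),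
        ((1 - e) * x, y + e * (1 - y))} := by
    rw [S, aff_hull]
    simp only [aff_apply]
    congr 2
    · simp
    congr 1
    · ext <;> simp only <;> ring
    congr 1
    · ext <;> simp only <;> rw [hl, hw] <;> ring
    congr 1
    · ext <;> simp only <;> ring
  rw [e3] at t3
  have d01 := sep y (1 - x) (l * y) (by positivity)
    (hull_le (a := (0, 0)) (b := (l, 0)) (c := (l * x, l * y)) (d := (0, l)) y (1 - x) (l * y)
      (by simp only; nlinarith) (by simp only; nlinarith) (by simp only; nlinarith)
      (by simp only; nlinarith))
    (hull_ge (a := (l, 0)) (b := (l * x, l * y)) (c := (x + e * (1 - x), (1 - e) * y))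
      (d := (1, 0)) y (1 - x) (l * y)
      (by simp only; nlinarith) (by simp only; nlinarith) (by simp only; nlinarith)
      (by simp only; nlinarith))
  have d02 := sep (1 - y) x (l * x) (by positivity)
    (hull_le (a := (0, 0)) (b := (l, 0)) (c := (l * x, l * y)) (d := (0, l)) (1 - y) x (l * x)
      (by simp only; nlinarith) (by simp only; nlinarith) (by simp only; nlinarith)
      (by simp only; nlinarith))
    (hull_ge (a := (0, l)) (b := (l * x, l * y)) (c := ((1 - e) * x, y + e * (1 - y)))
      (d := (0, 1)) (1 - y) x (l * x)
      (by simp only; nlinarith) (by simp only; nlinarith) (by simp only; nlinarith)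
      (by simp only; nlinarith))
  have d12 := sep (-y) x 0 (by positivity)
    (hull_le (a := (l, 0)) (b := (l * x, l * y)) (c := (x + e * (1 - x), (1 - e) * y))
      (d := (1, 0)) (-y) x 0
      (by simp only; nlinarith) (by simp only; nlinarith) (by simp only; nlinarith)
      (by simp only; nlinarith))
    (hull_ge (a := (0, l)) (b := (l * x, l * y)) (c := ((1 - e) * x, y + e * (1 - y)))
      (d := (0, 1)) (-y) x 0
      (by simp only; nlinarith) (by simp only; nlinarith) (by simp only; nlinarith)
      (by simp only; nlinarith))
  have q1 : 0 < y * (w - e * w) := mul_pos hy (by linarith)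
  have q2 : 0 < x * (w - e * w) := mul_pos hx (by linarith)
  have q3 : 0 < e * w * w := by positivity
  have q4 : 0 < e * w * y := by positivity
  have q5 : 0 < e * w * x := by positivity
  have hy' : y = w + 1 - x := by linarith
  have d03 := sep 1 1 (l * (x + y)) (by norm_num)
    (hull_le (a := (0, 0)) (b := (l, 0)) (c := (l * x, l * y)) (d := (0, l)) 1 1 (l * (x + y))
      (by simp only; nlinarith) (by simp only; nlinarith) (by simp only; nlinarith)
      (by simp only; nlinarith))
    (hull_ge (a := (x, y)) (b := (x + e * (1 - x), (1 - e) * y)) (c := (l * x, l * y))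
      (d := ((1 - e) * x, y + e * (1 - y))) 1 1 (l * (x + y))
      (by simp only; nlinarith)
      (by simp only; subst hl; subst hy'; linear_combination q3)
      (by simp only; nlinarith)
      (by simp only; subst hl; subst hy'; linear_combination q3))
  have d13 := sep ((1 - w) * y) (1 - (1 - w) * x) (l * y)
    (by have : 0 < (1 - w) * y := mul_pos (by linarith) hy
        positivity)
    (hull_le (a := (l, 0)) (b := (l * x, l * y)) (c := (x + e * (1 - x), (1 - e) * y))
      (d := (1, 0)) _ _ _
      (by simp only; nlinarith [mul_pos hly hw0])
      (by simp only; subst hl; nlinarith)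
      (by simp only; subst hl; exact le_of_eq (by ring))
      (by simp only; subst hl; linear_combination q1))
    (hull_ge (a := (x, y)) (b := (x + e * (1 - x), (1 - e) * y)) (c := (l * x, l * y))
      (d := ((1 - e) * x, y + e * (1 - y))) _ _ _
      (by simp only; nlinarith) (by simp only; subst hl; exact le_of_eq (by ring))
      (by simp only; exact le_of_eq (by ring))
      (by simp only; subst hl; subst hy'; linear_combination q3))
  have d23 := sep (1 - (1 - w) * y) ((1 - w) * x) (l * x)
    (by have : 0 < (1 - w) * x := mul_pos (by linarith) hx
        positivity)
    (hull_le (a := (0, l)) (b := (l * x, l * y)) (c := ((1 - e) * x, y + e * (1 - y)))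
      (d := (0, 1)) _ _ _
      (by simp only; nlinarith [mul_pos hlx hw0])
      (by simp only; subst hl; nlinarith)
      (by simp only; subst hl; exact le_of_eq (by ring))
      (by simp only; subst hl; linear_combination q2))
    (hull_ge (a := (x, y)) (b := (x + e * (1 - x), (1 - e) * y)) (c := (l * x, l * y))
      (d := ((1 - e) * x, y + e * (1 - y))) _ _ _
      (by simp only; nlinarith)
      (by simp only; subst hl; subst hy'; linear_combination q3)
      (by simp only; exact le_of_eq (by ring))
      (by simp only; subst hl; exact le_of_eq (by ring)))
  have := ((t0.add t1 d01).add t2 (disj_union (hull_closed _ _ _ _) d02 d12)).add t3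
    (disj_union ((hull_closed _ _ _ _).union (hull_closed _ _ _ _))
      (disj_union (hull_closed _ _ _ _) d03 d13) d23)
  convert this using 1
  apply subset_antisymm
  · rintro ⟨u, v⟩ hp
    obtain ⟨h1, h2, h3, h4⟩ := S_ineq hx hy hxy hp
    simp only at h1 h2 h3 h4
    by_cases hP0 : y * u + (1 - x) * v ≤ l * y ∧ (1 - y) * u + x * v ≤ l * x
    · left; left; left
      apply hull_mem <;> simp only [cr] <;> nlinarith
    by_cases hB : l * y ≤ y * u + (1 - x) * v ∧ (1 - w) * y * u + (1 - (1 - w) * x) * v ≤ l * y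
    · left; left; right
      rw [hull_rev]
      obtain ⟨hB1, hB2⟩ := hB
      have c1 : cr (1, 0) (x + e * (1 - x), (1 - e) * y) (u, v)
          = (1 - e) * (y - (y * u + (1 - x) * v)) := by simp only [cr]; ring
      have c2 : cr (x + e * (1 - x), (1 - e) * y) (l * x, l * y) (u, v)
          = e * (l * y - ((1 - w) * y * u + (1 - (1 - w) * x) * v)) := by
        simp only [cr]; rw [hl]; ring
      have c3 : cr (l * x, l * y) (l, 0) (u, v) = l * (y * u + (1 - x) * v - l * y) := by
        simp only [cr]; ring
      have c4 : cr (l, 0) (1, 0) (u, v) = (1 - l) * v := by simp only [cr]; ring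
      have c5 : cr (1, 0) (x + e * (1 - x), (1 - e) * y) (l * x, l * y)
          = (1 - e) * (1 - l) * y := by simp only [cr]; ring
      have c6 : cr (1, 0) (l * x, l * y) (l, 0) = l * (1 - l) * y := by simp only [cr]; ring
      apply hull_mem
      · rw [c5]; exact mul_pos (mul_pos (by linarith) (by linarith)) hy
      · rw [c6]; exact mul_pos (mul_pos (by linarith) (by linarith)) hy
      · rw [c1]; exact mul_nonneg (by linarith) (by linarith)
      · rw [c2]; exact mul_nonneg (by linarith) (by linarith)
      · rw [c3]; exact mul_nonneg (by linarith) (by linarith)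
      · rw [c4]; exact mul_nonneg (by linarith) (by linarith)
    by_cases hD : l * x ≤ (1 - y) * u + x * v ∧ (1 - (1 - w) * y) * u + (1 - w) * x * v ≤ l * x
    · left; right
      obtain ⟨hD1, hD2⟩ := hD
      have c1 : cr (0, l) (l * x, l * y) (u, v) = l * ((1 - y) * u + x * v - l * x) := by
        simp only [cr]; ring
      have c2 : cr (l * x, l * y) ((1 - e) * x, y + e * (1 - y)) (u, v)
          = e * (l * x - ((1 - (1 - w) * y) * u + (1 - w) * x * v)) := by
        simp only [cr]; rw [hl]; ring
      have c3 : cr ((1 - e) * x, y + e * (1 - y)) (0, 1) (u, v)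
          = (1 - e) * (x - ((1 - y) * u + x * v)) := by simp only [cr]; ring
      have c4 : cr (0, 1) (0, l) (u, v) = (1 - l) * u := by simp only [cr]; ring
      have c5 : cr (0, l) (l * x, l * y) ((1 - e) * x, y + e * (1 - y))
          = l * (1 - l) * x := by simp only [cr]; ring
      have c6 : cr (0, l) ((1 - e) * x, y + e * (1 - y)) (0, 1) = (1 - e) * (1 - l) * x := by
        simp only [cr]; ring
      apply hull_mem
      · rw [c5]; exact mul_pos (mul_pos (by linarith) (by linarith)) hx
      · rw [c6]; exact mul_pos (mul_pos (by linarith) (by linarith)) hx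
      · rw [c1]; exact mul_nonneg (by linarith) (by linarith)
      · rw [c2]; exact mul_nonneg (by linarith) (by linarith)
      · rw [c3]; exact mul_nonneg (by linarith) (by linarith)
      · rw [c4]; exact mul_nonneg (by linarith) (by linarith)
    by_cases hR : l * y ≤ (1 - w) * y * u + (1 - (1 - w) * x) * v ∧
        l * x ≤ (1 - (1 - w) * y) * u + (1 - w) * x * v
    · right
      rw [hull_rev]
      obtain ⟨hR1, hR2⟩ := hR
      have c1 : cr ((1 - e) * x, y + e * (1 - y)) (l * x, l * y) (u, v)
          = e * ((1 - (1 - w) * y) * u + (1 - w) * x * v - l * x) := by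
        simp only [cr]; rw [hl]; ring
      have c2 : cr (l * x, l * y) (x + e * (1 - x), (1 - e) * y) (u, v)
          = e * ((1 - w) * y * u + (1 - (1 - w) * x) * v - l * y) := by
        simp only [cr]; rw [hl]; ring
      have c3 : cr (x + e * (1 - x), (1 - e) * y) (x, y) (u, v)
          = e * (y - (y * u + (1 - x) * v)) := by simp only [cr]; ring
      have c4 : cr (x, y) ((1 - e) * x, y + e * (1 - y)) (u, v)
          = e * (x - ((1 - y) * u + x * v)) := by simp only [cr]; ring
      have c5 : cr ((1 - e) * x, y + e * (1 - y)) (l * x, l * y) (x + e * (1 - x), (1 - e) * y)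
          = e * e * (w * w) := by
        simp only [cr]; subst hl; subst hw; ring
      have c6 : cr ((1 - e) * x, y + e * (1 - y)) (x + e * (1 - x), (1 - e) * y) (x, y)
          = e * e * w := by
        simp only [cr]; subst hw; ring
      apply hull_mem
      · rw [c5]; positivity
      · rw [c6]; positivity
      · rw [c1]; exact mul_nonneg (by linarith) (by linarith)
      · rw [c2]; exact mul_nonneg (by linarith) (by linarith)
      · rw [c3]; exact mul_nonneg (by linarith) (by linarith)
      · rw [c4]; exact mul_nonneg (by linarith) (by linarith)
    exfalso
    rcases le_or_gt (l * y) (y * u + (1 - x) * v) with hf | hf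
    · have hL : l * y < (1 - w) * y * u + (1 - (1 - w) * x) * v := by
        by_contra h; exact hB ⟨hf, not_lt.1 h⟩
      have hM : (1 - (1 - w) * y) * u + (1 - w) * x * v < l * x := by
        by_contra h; exact hR ⟨hL.le, not_lt.1 h⟩
      have hg : (1 - y) * u + x * v < l * x := by
        by_contra h; exact hD ⟨not_lt.1 h, hM.le⟩
      exact cover_aux (x := x) (y := y) (w := w) (f := y * u + (1 - x) * v - l * y)
        (g := (1 - y) * u + x * v - l * x)
        (L := (1 - w) * y * u + (1 - (1 - w) * x) * v - l * y)
        (M := (1 - (1 - w) * y) * u + (1 - w) * x * v - l * x) hx hy hw0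
        (by rw [hw]; ring) (by rw [hw]; ring)
        (by linarith) (by linarith) (by linarith) (by linarith)
    · have hg : l * x < (1 - y) * u + x * v := by
        by_contra h; exact hP0 ⟨hf.le, not_lt.1 h⟩
      have hM : l * x < (1 - (1 - w) * y) * u + (1 - w) * x * v := by
        by_contra h; exact hD ⟨hg.le, not_lt.1 h⟩
      have hL : (1 - w) * y * u + (1 - (1 - w) * x) * v < l * y := by
        by_contra h; exact hR ⟨not_lt.1 h, hM.le⟩
      exact cover_aux (x := y) (y := x) (w := w) (g := y * u + (1 - x) * v - l * y)
        (f := (1 - y) * u + x * v - l * x)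
        (M := (1 - w) * y * u + (1 - (1 - w) * x) * v - l * y)
        (L := (1 - (1 - w) * y) * u + (1 - w) * x * v - l * x) hy hx hw0
        (by rw [hw]; ring) (by rw [hw]; ring)
        (by linarith) (by linarith) (by linarith) (by linarith)
  · have hconv : Convex ℝ (S x y) := convex_convexHull _ _
    have hC : (x, y) ∈ S x y := subset_convexHull _ _ (by simp)
    have hF : (x + e * (1 - x), (1 - e) * y) ∈ S x y := by
      apply S_mem hx hy <;> simp only <;> nlinarith [mul_pos he0 hx, mul_pos he0 hy]
    have hG : ((1 - e) * x, y + e * (1 - y)) ∈ S x y := by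
      apply S_mem hx hy <;> simp only <;> nlinarith [mul_pos he0 hx, mul_pos he0 hy]
    have hO : (l * x, l * y) ∈ S x y := by
      apply S_mem hx hy <;> simp only <;> nlinarith
    refine union_subset (union_subset (union_subset (hull_sub hconv ?_ ?_ ?_ ?_)
      (hull_sub hconv ?_ ?_ ?_ ?_)) (hull_sub hconv ?_ ?_ ?_ ?_)) (hull_sub hconv ?_ ?_ ?_ ?_) <;>
    first
    | assumption
    | (apply S_mem hx hy <;> simp only <;> nlinarith)

lemma core {x y : ℝ} (hx : 0 < x) (hy : 0 < y) (hy1 : y < 1) (hxy : 1 < x + y) (hxy2 : x + y < 2)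
    (n : ℕ) (hn : 5 ≤ n) : IsSelfAffine n (S x y) := by
  have t := S_two_tile hx hy hy1 hxy
  obtain ⟨k, hk⟩ : ∃ k, k = y * ((x + y - 1) / x) := ⟨_, rfl⟩
  rw [← hk] at t
  have q0 : 0 < (x + y - 1) / x := div_pos (by linarith) hx
  have q1 : (x + y - 1) / x < 1 := by rw [div_lt_one hx]; linarith
  have hk0 : 0 < k := by rw [hk]; positivity
  have hk1 : k < 1 := by rw [hk]; nlinarith
  rcases Nat.even_or_odd n with h | h
  · obtain ⟨m, rfl⟩ : ∃ m, n = 1 + 2 + 2 * (m + 1) + 1 := by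
      obtain ⟨r, rfl⟩ := h
      exact ⟨r - 3, by omega⟩
    exact even_step hx hy hxy hxy2 hk0 hk1 t (trap_even hk0 t m)
  · obtain ⟨m, rfl⟩ : ∃ m, n = 1 + 2 + 2 * (m + 1) := by
      obtain ⟨r, rfl⟩ := h
      exact ⟨r - 2, by omega⟩
    exact odd_step hx hy hxy hk0 hk1 t (trap_even hk0 t m)

lemma swap {x y : ℝ} {n : ℕ} (h : IsSelfAffine n (S x y)) : IsSelfAffine n (S y x) := by
  have := selfAffine_image (aff (0, 0) (0, 1) (1, 0) (by norm_num)) h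
  convert this using 1
  rw [S, S, aff_hull]
  simp only [aff_apply]
  congr 1
  ext z
  simp
  tauto

lemma mid {x y : ℝ} (hx : 0 < x) (hy : 0 < y) (hxy : 1 < x + y) (hxy2 : x + y < 2)
    (n : ℕ) (hn : 5 ≤ n) : IsSelfAffine n (S x y) := by
  rcases lt_or_ge y 1 with h | h
  · exact core hx hy h hxy hxy2 n hn
  · exact swap (core hy hx (by linarith) (by linarith) (by linarith) n hn)

lemma mid_eq {x y : ℝ} (hx : 0 < x) (hxy : x + y = 2) (hlt : x < y)
    (n : ℕ) (hn : 5 ≤ n) : IsSelfAffine n (S x y) := by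
  have hy : 0 < y := by linarith
  have i0 : 0 < 1 / y := by positivity
  have i1 : 1 / y < 1 := by rw [div_lt_one hy]; linarith
  have i2 : 1 / 2 < 1 / y := one_div_lt_one_div_of_lt hy (by linarith)
  have iy : 1 / y * y = 1 := div_mul_cancel₀ _ hy.ne'
  have h := mid i0 i0 (by linarith) (by linarith) n hn
  obtain ⟨t, ht⟩ : ∃ t, t = 1 / y := ⟨_, rfl⟩
  rw [← ht] at h iy
  have := selfAffine_image (aff (1, 0) (x - 1, y) (-1, 0) (by simp; exact hy.ne')) h
  convert this using 1
  rw [S, S, aff_hull]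
  simp only [aff_apply]
  have hh : (1 : ℝ) + (t * (x - 1) + t * -1) = 0 := by
    linear_combination t * hxy - iy
  rw [hh]
  have h2 : (0 : ℝ) + (t * y + t * 0) = 1 := by linarith
  rw [h2]
  congr 1
  ext z
  simp
  tauto

lemma par (n : ℕ) : Tile (S 1 1) (n + 1) (S 1 1) := by
  induction n with
  | zero =>
    have := Tile.one (S 1 1) (AffineEquiv.refl ℝ _)
    simpa using this
  | succ n ih =>
    have t1 := Tile.one (S 1 1) (aff (0, 0) (1 / 2, 0) (0, 1) (by norm_num))
    have t2 := ih.image (aff (1 / 2, 0) (1 / 2, 0) (0, 1) (by norm_num))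
    have ine : ∀ {p}, p ∈ S 1 1 → 0 ≤ p.1 ∧ 0 ≤ p.2 ∧ p.1 ≤ 1 ∧ p.2 ≤ 1 := by
      intro p hp
      obtain ⟨h1, h2, h3, h4⟩ := S_ineq one_pos one_pos (by norm_num) hp
      exact ⟨h1, h2, by linarith, by linarith⟩
    have q1 : ∀ z ∈ aff (0, 0) (1 / 2, 0) (0, 1) (by norm_num) '' S 1 1,
        1 * z.1 + 0 * z.2 ≤ 1 / 2 := by
      rintro _ ⟨z, hz, rfl⟩
      obtain ⟨h1, h2, h3, h4⟩ := ine hz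
      simp only [aff_apply]; linarith
    have q2 : ∀ z ∈ aff (1 / 2, 0) (1 / 2, 0) (0, 1) (by norm_num) '' S 1 1,
        1 / 2 ≤ 1 * z.1 + 0 * z.2 := by
      rintro _ ⟨z, hz, rfl⟩
      obtain ⟨h1, h2, h3, h4⟩ := ine hz
      simp only [aff_apply]; linarith
    have := t2.add t1 (sep 1 0 (1 / 2) (by norm_num) q1 q2).symm
    convert this using 1
    apply subset_antisymm
    · rintro ⟨u, v⟩ hz
      obtain ⟨h1, h2, h3, h4⟩ := ine hz
      simp only at h1 h2 h3 h4
      rcases le_total u (1 / 2) with h | h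
      · right
        refine ⟨(2 * u, v), S_mem one_pos one_pos ?_ ?_ ?_ ?_, ?_⟩
        · simp only; linarith
        · simp only; linarith
        · simp only; linarith
        · simp only; linarith
        · ext <;> simp only [aff_apply] <;> ring
      · left
        refine ⟨(2 * u - 1, v), S_mem one_pos one_pos ?_ ?_ ?_ ?_, ?_⟩
        · simp only; linarith
        · simp only; linarith
        · simp only; linarith
        · simp only; linarith
        · ext <;> simp only [aff_apply] <;> ring
    · refine union_subset ?_ ?_ <;> rintro _ ⟨z, hz, rfl⟩ <;> obtain ⟨h1, h2, h3, h4⟩ := ine hz <;>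
      apply S_mem one_pos one_pos <;> simp only [aff_apply] <;> linarith

lemma S_all {x y : ℝ} (hx : 0 < x) (hy : 0 < y) (hxy : 1 < x + y)
    (n : ℕ) (hn : 5 ≤ n) : IsSelfAffine n (S x y) := by
  rcases lt_trichotomy (x + y) 2 with h | h | h
  · exact mid hx hy hxy h n hn
  · rcases lt_trichotomy x y with h' | h' | h'
    · exact mid_eq hx h h' n hn
    · obtain rfl : x = 1 := by linarith
      obtain rfl : y = 1 := by linarith
      obtain ⟨m, rfl⟩ : ∃ m, n = m + 1 := ⟨n - 1, by omega⟩
      exact par m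
    · exact swap (mid_eq hy (by linarith) h' n hn)
  · have hw : 0 < x + y - 1 := by linarith
    obtain ⟨t, ht⟩ : ∃ t, t = 1 / (x + y - 1) := ⟨_, rfl⟩
    have iy : t * (x + y - 1) = 1 := by rw [ht]; exact div_mul_cancel₀ _ hw.ne'
    have t0 : 0 < t := by rw [ht]; positivity
    have h' := mid (x := t * x) (y := t * y) (by positivity) (by positivity) (by nlinarith)
      (by nlinarith) n hn
    have hne : (1 - x) * (1 - y) - (-y) * (-x) ≠ 0 := by
      intro h; linarith
    have := selfAffine_image (aff (x, y) (1 - x, -y) (-x, 1 - y) hne) h'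
    convert this using 1
    rw [S, S, aff_hull]
    simp only [aff_apply]
    have h1 : x + (t * x * (1 - x) + t * y * -x) = 0 := by linear_combination (-x) * iy
    have h2 : y + (t * x * -y + t * y * (1 - y)) = 0 := by linear_combination (-y) * iy
    rw [h1, h2]
    congr 1
    ext z
    simp
    tauto

lemma quad_all {A B C D : ℝ × ℝ} {x y : ℝ} (hx : 0 < x) (hy : 0 < y) (hxy : 1 < x + y)
    (h : cr A B D ≠ 0) (h1 : C.1 = A.1 + (x * (B.1 - A.1) + y * (D.1 - A.1)))
    (h2 : C.2 = A.2 + (x * (B.2 - A.2) + y * (D.2 - A.2)))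
    (n : ℕ) (hn : 5 ≤ n) : IsSelfAffine n (convexHull ℝ {A, B, C, D}) := by
  have hne : (B.1 - A.1) * (D.2 - A.2) - (B.2 - A.2) * (D.1 - A.1) ≠ 0 := h
  have := selfAffine_image (aff A (B.1 - A.1, B.2 - A.2) (D.1 - A.1, D.2 - A.2) hne)
    (S_all hx hy hxy n hn)
  convert this using 1
  rw [S, aff_hull]
  simp only [aff_apply]
  rw [← h1, ← h2]
  simp

lemma comb3 {a b c p : ℝ × ℝ} {α β γ : ℝ} (hα : 0 ≤ α) (hβ : 0 ≤ β) (hγ : 0 ≤ γ)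
    (hs : α + β + γ = 1) (h1 : p.1 = α * a.1 + β * b.1 + γ * c.1)
    (h2 : p.2 = α * a.2 + β * b.2 + γ * c.2) : p ∈ convexHull ℝ ({a, b, c} : Set (ℝ × ℝ)) := by
  have hsub := subset_convexHull ℝ ({a, b, c} : Set (ℝ × ℝ))
  have key := (convex_convexHull ℝ ({a, b, c} : Set (ℝ × ℝ))).sum_mem (t := Finset.univ)
    (w := ![α, β, γ]) (z := ![a, b, c]) ?_ ?_ ?_
  · simp only [Fin.sum_univ_three, Matrix.cons_val_zero, Matrix.cons_val_one, Matrix.cons_val] at key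
    convert key using 1
    ext
    · simpa using h1
    · simpa using h2
  · intro i _
    fin_cases i <;> simp <;> assumption
  · simpa [Fin.sum_univ_three] using hs
  · intro i _
    fin_cases i <;> apply hsub <;> simp

lemma noncol {a b c : ℝ × ℝ} (ha : a ∉ segment ℝ b c) (hb : b ∉ segment ℝ a c)
    (hc : c ∉ segment ℝ a b) : cr a b c ≠ 0 := by
  intro h
  have hab : b ≠ a := by
    rintro rfl
    exact ha (left_mem_segment ℝ _ _)
  have hcol : Collinear ℝ ({a, b, c} : Set (ℝ × ℝ)) := by
    rw [collinear_iff_of_mem (p₀ := a) (by simp)]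
    refine ⟨b - a, ?_⟩
    have hr : ∃ r : ℝ, c.1 - a.1 = r * (b.1 - a.1) ∧ c.2 - a.2 = r * (b.2 - a.2) := by
      simp only [cr] at h
      by_cases h1 : b.1 - a.1 = 0
      · have h2 : b.2 - a.2 ≠ 0 := by
          intro h2
          exact hab (Prod.ext (by linarith) (by linarith))
        refine ⟨(c.2 - a.2) / (b.2 - a.2), ?_, ?_⟩
        · rw [div_mul_eq_mul_div, eq_div_iff h2]; linarith
        · rw [div_mul_cancel₀ _ h2]
      · refine ⟨(c.1 - a.1) / (b.1 - a.1), ?_, ?_⟩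
        · rw [div_mul_cancel₀ _ h1]
        · rw [div_mul_eq_mul_div, eq_div_iff h1]; linarith
    obtain ⟨r, hr1, hr2⟩ := hr
    intro p hp
    simp only [mem_insert_iff, mem_singleton_iff] at hp
    rcases hp with rfl | rfl | rfl
    · exact ⟨0, by simp⟩
    · exact ⟨1, by simp⟩
    · refine ⟨r, ?_⟩
      ext
      · simp; linarith
      · simp; linarith
  rcases hcol.wbtw_or_wbtw_or_wbtw with h | h | h
  · exact hb h.mem_segment
  · exact hc (by rw [segment_symm]; rw [segment_symm] at *; exact (by simpa [segment_symm] using h.mem_segment))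
  · exact ha (by rw [segment_symm]; exact h.mem_segment)

/-- Every convex quadrangle is `n`-self-affine for every `n ≥ 5`. -/
theorem convexQuadrangle_self_affine (Q : Set (ℝ × ℝ)) (hQ : IsConvexQuadrangle Q)
    (n : ℕ) (hn : 5 ≤ n) : IsSelfAffine n Q := by
  obtain ⟨a, b, c, d, rfl, ha, hb, hc, hd⟩ := hQ
  have seg : ∀ {p q r s t : ℝ × ℝ}, p ∉ convexHull ℝ ({r, s, t} : Set (ℝ × ℝ)) →
      q ∈ ({r, s, t} : Set (ℝ × ℝ)) → ∀ q' ∈ ({r, s, t} : Set (ℝ × ℝ)), p ∉ segment ℝ q q' := by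
    intro p q r s t hp hq q' hq' hmem
    exact hp (segment_subset_convexHull hq hq' hmem)
  have n1 : cr a b c ≠ 0 := noncol (seg ha (by simp) _ (by simp)) (seg hb (by simp) _ (by simp))
    (seg hc (by simp) _ (by simp))
  have n2 : cr b c d ≠ 0 := noncol (seg hb (by simp) _ (by simp)) (seg hc (by simp) _ (by simp))
    (seg hd (by simp) _ (by simp))
  have n3 : cr c a d ≠ 0 := noncol (seg hc (by simp) _ (by simp)) (seg ha (by simp) _ (by simp))
    (seg hd (by simp) _ (by simp))
  have n4 : cr a b d ≠ 0 := noncol (seg ha (by simp) _ (by simp)) (seg hb (by simp) _ (by simp))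
    (seg hd (by simp) _ (by simp))
  obtain ⟨z, hz⟩ : ∃ z, z = cr b c d / cr a b c := ⟨_, rfl⟩
  obtain ⟨x, hx⟩ : ∃ x, x = cr c a d / cr a b c := ⟨_, rfl⟩
  obtain ⟨y, hy⟩ : ∃ y, y = cr a b d / cr a b c := ⟨_, rfl⟩
  have z0 : z ≠ 0 := by rw [hz]; exact div_ne_zero n2 n1
  have x0 : x ≠ 0 := by rw [hx]; exact div_ne_zero n3 n1
  have y0 : y ≠ 0 := by rw [hy]; exact div_ne_zero n4 n1
  have hs : z + x + y = 1 := by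
    rw [hz, hx, hy, ← add_div, ← add_div, div_eq_iff n1]; simp only [cr]; ring
  have d1 : d.1 = z * a.1 + x * b.1 + y * c.1 := by
    rw [hz, hx, hy, div_mul_eq_mul_div, div_mul_eq_mul_div, div_mul_eq_mul_div, ← add_div,
      ← add_div, eq_div_iff n1]
    simp only [cr]; ring
  have d2 : d.2 = z * a.2 + x * b.2 + y * c.2 := by
    rw [hz, hx, hy, div_mul_eq_mul_div, div_mul_eq_mul_div, div_mul_eq_mul_div, ← add_div,
      ← add_div, eq_div_iff n1]
    simp only [cr]; ring
  clear hx hy hz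
  -- a point with one positive and two negative weights in `d` is impossible
  have neg : ∀ {p q r : ℝ × ℝ} {α β γ : ℝ}, 0 < α → β < 0 → γ < 0 → α + β + γ = 1 →
      d.1 = α * p.1 + β * q.1 + γ * r.1 → d.2 = α * p.2 + β * q.2 + γ * r.2 →
      p ∈ convexHull ℝ ({q, r, d} : Set (ℝ × ℝ)) := by
    intro p q r α β γ h1 h2 h3 h4 h5 h6
    refine comb3 (α := -β / α) (β := -γ / α) (γ := 1 / α) (div_nonneg (by linarith) h1.le)
      (div_nonneg (by linarith) h1.le) (by positivity) ?_ ?_ ?_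
    · rw [← add_div, ← add_div, div_eq_iff h1.ne']; linarith
    · rw [div_mul_eq_mul_div, div_mul_eq_mul_div, div_mul_eq_mul_div, ← add_div,
        ← add_div, eq_div_iff h1.ne']; linarith
    · rw [div_mul_eq_mul_div, div_mul_eq_mul_div, div_mul_eq_mul_div, ← add_div,
        ← add_div, eq_div_iff h1.ne']; linarith
  have nba : cr b a c ≠ 0 := by
    intro h; apply n1; simp only [cr] at *; linarith
  have nca : cr c a b ≠ 0 := by
    intro h; apply n1; simp only [cr] at *; linarith
  rcases lt_or_gt_of_ne z0 with hz | hz <;> rcases lt_or_gt_of_ne x0 with hx | hx <;>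
  rcases lt_or_gt_of_ne y0 with hy | hy
  · linarith
  · exact absurd (neg hy hz hx (by linarith) (by linarith) (by linarith)) hc
  · exact absurd (neg hx hz hy (by linarith) (by linarith) (by linarith)) hb
  · have := quad_all (A := a) (B := b) (C := d) (D := c) hx hy (by linarith) n1
      (by linear_combination d1 + a.1 * hs) (by linear_combination d2 + a.2 * hs) n hn
    convert this using 2
    ext t; simp only [mem_insert_iff, mem_singleton_iff]; tauto
  · exact absurd (neg hz hx hy (by linarith) (by linarith) (by linarith)) ha
  · have := quad_all (A := b) (B := a) (C := d) (D := c) hz hy (by linarith) nba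
      (by linear_combination d1 + b.1 * hs) (by linear_combination d2 + b.2 * hs) n hn
    convert this using 2
    ext t; simp only [mem_insert_iff, mem_singleton_iff]; tauto
  · have := quad_all (A := c) (B := a) (C := d) (D := b) hz hx (by linarith) nca
      (by linear_combination d1 + c.1 * hs) (by linear_combination d2 + c.2 * hs) n hn
    convert this using 2
    ext t; simp only [mem_insert_iff, mem_singleton_iff]; tauto
  · exact absurd (comb3 hz.le hx.le hy.le hs d1 d2) hd
end

section
/- For all real numbers α₁, β₁, α₂, β₂ with 0 < α₁ < β₁ < 1, 0 < α₂ < β₂ < 1 and α₁β₂ < α₂β₁, the quadrangle Q(α₁β₂, α₂β₁) admits a dissection into two pieces, one affinely equivalent to Q(α₁, β₁) and the other affinely equivalent to Q(α₂, β₂). -/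
open Set

/-- For `0 < α < β < 1`, `Qab α β` is the convex quadrangle `Q(α,β)` with vertices
`a = (0,0)`, `b = (1−α,0)`, `c = (1−β, 1−(1−β)/(1−α))`, `d = (0, 1−α(1−β)/((1−α)β))`. -/
noncomputable def Qab (α β : ℝ) : Set (ℝ × ℝ) :=
  convexHull ℝ {((0 : ℝ), (0 : ℝ)), (1 - α, 0), (1 - β, 1 - (1 - β) / (1 - α)),
    (0, 1 - α * (1 - β) / ((1 - α) * β))}

/-- For `0 < γ < 1`, `Tg γ` is the trapezoid `T(γ)` with vertices
`(0,0)`, `(1,0)`, `(γ,1)`, `(0,1)`. -/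
noncomputable def Tg (γ : ℝ) : Set (ℝ × ℝ) :=
  convexHull ℝ {((0 : ℝ), (0 : ℝ)), (1, 0), (γ, 1), (0, 1)}

/-- `B` is the image of `A` under an invertible affine map of the plane,
i.e. `A` and `B` are affinely equivalent. -/
def AffineCopy (A B : Set (ℝ × ℝ)) : Prop :=
  ∃ φ : (ℝ × ℝ) ≃ᵃ[ℝ] (ℝ × ℝ), φ '' A = B

/-- Linear equivalence given by an invertible 2x2 matrix. -/
noncomputable def linMap (a b c d : ℝ) (h : a * d - b * c ≠ 0) : (ℝ × ℝ) ≃ₗ[ℝ] (ℝ × ℝ) where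
  toFun z := (a * z.1 + b * z.2, c * z.1 + d * z.2)
  map_add' x y := by ext <;> simp <;> ring
  map_smul' r x := by ext <;> simp <;> ring
  invFun z := ((d * z.1 - b * z.2) / (a * d - b * c), (a * z.2 - c * z.1) / (a * d - b * c))
  left_inv z := by
    ext
    · simp only
      rw [div_eq_iff h]; ring
    · simp only
      rw [div_eq_iff h]; ring
  right_inv z := by
    ext
    · simp only
      rw [mul_div_assoc', mul_div_assoc', ← add_div, div_eq_iff h]; ring
    · simp only
      rw [mul_div_assoc', mul_div_assoc', ← add_div, div_eq_iff h]; ring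

noncomputable def affMap (a b c d e f : ℝ) (h : a * d - b * c ≠ 0) : (ℝ × ℝ) ≃ᵃ[ℝ] (ℝ × ℝ) :=
  (linMap a b c d h).toAffineEquiv.trans (AffineEquiv.constVAdd ℝ (ℝ × ℝ) ((e, f) : ℝ × ℝ))

lemma affMap_apply (a b c d e f : ℝ) (h : a * d - b * c ≠ 0) (x y : ℝ) :
    affMap a b c d e f h (x, y) = (e + (a * x + b * y), f + (c * x + d * y)) := by
  simp [affMap, linMap]

def Hull (p q s t : ℝ) : Set (ℝ × ℝ) :=
  convexHull ℝ {((p : ℝ), (0 : ℝ)), (s, 0), (0, q), (0, t)}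

lemma image_hull (φ : (ℝ × ℝ) ≃ᵃ[ℝ] (ℝ × ℝ)) (A B C D : ℝ × ℝ) :
    φ '' convexHull ℝ {A, B, C, D} = convexHull ℝ {φ A, φ B, φ C, φ D} := by
  have := AffineMap.image_convexHull (φ : (ℝ × ℝ) →ᵃ[ℝ] (ℝ × ℝ)) {A, B, C, D}
  simp only [AffineEquiv.coe_toAffineMap, Set.image_insert_eq, Set.image_singleton] at this
  exact this

lemma AffineCopy.symm' {A B : Set (ℝ × ℝ)} (h : AffineCopy A B) : AffineCopy B A := by
  obtain ⟨φ, rfl⟩ := h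
  refine ⟨φ.symm, ?_⟩
  rw [← Set.image_comp]
  simp

lemma AffineCopy.trans' {A B C : Set (ℝ × ℝ)} (h : AffineCopy A B) (h' : AffineCopy B C) :
    AffineCopy A C := by
  obtain ⟨φ, rfl⟩ := h
  obtain ⟨ψ, rfl⟩ := h'
  refine ⟨φ.trans ψ, ?_⟩
  rw [← Set.image_comp]
  rfl

lemma hull_copy_Qab (α β : ℝ) (h0 : 0 < α) (h1 : α < β) (h2 : β < 1) :
    AffineCopy (Hull α β 1 1) (Qab α β) := by
  have hα : 1 - α ≠ 0 := by linarith
  have hβ : β ≠ 0 := by linarith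
  have hD : 1 - α * (1 - β) / ((1 - α) * β) = (β - α) / ((1 - α) * β) := by
    field_simp; ring
  have hC : 1 - (1 - β) / (1 - α) = (β - α) / ((1 - α) * β) * β := by
    field_simp; ring
  have hne : (β - α) / ((1 - α) * β) ≠ 0 := by
    have : β - α ≠ 0 := by linarith
    positivity
  refine ⟨affMap (-1) (-1) 0 ((β - α) / ((1 - α) * β)) 1 0 (by simpa using hne), ?_⟩
  rw [Hull, image_hull, Qab, hD, hC]
  simp only [affMap_apply]
  congr 1
  ext z
  simp only [Set.mem_insert_iff, Set.mem_singleton_iff]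
  have e1 : ((1 + (-1 * α + -1 * 0), 0 + (0 * α + (β - α) / ((1 - α) * β) * 0)) : ℝ × ℝ)
    = (1 - α, 0) := by ext <;> simp <;> ring
  have e2 : ((1 + (-1 * 1 + -1 * 0), 0 + (0 * 1 + (β - α) / ((1 - α) * β) * 0)) : ℝ × ℝ)
    = (0, 0) := by ext <;> simp
  have e3 : ((1 + (-1 * 0 + -1 * β), 0 + (0 * 0 + (β - α) / ((1 - α) * β) * β)) : ℝ × ℝ)
    = (1 - β, (β - α) / ((1 - α) * β) * β) := by ext <;> simp <;> ring
  have e4 : ((1 + (-1 * 0 + -1 * 1), 0 + (0 * 0 + (β - α) / ((1 - α) * β) * 1)) : ℝ × ℝ)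
    = (0, (β - α) / ((1 - α) * β)) := by ext <;> simp
  rw [e1, e2, e3, e4]
  tauto

lemma hull_scale (p q k l : ℝ) (hk : k ≠ 0) (hl : l ≠ 0) :
    AffineCopy (Hull p q 1 1) (Hull (k * p) (l * q) k l) := by
  refine ⟨affMap k 0 0 l 0 0 (by simp [hk, hl]), ?_⟩
  rw [Hull, image_hull, Hull]
  simp [affMap_apply]

lemma hull_swap (p q : ℝ) :
    AffineCopy (Hull p q 1 1) (Hull q p 1 1) := by
  refine ⟨affMap 0 1 1 0 0 0 (by simp), ?_⟩
  rw [Hull, image_hull, Hull]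
  simp only [affMap_apply]
  congr 1
  ext z
  simp
  tauto

lemma hull_eq (p q s t : ℝ) (hp : 0 < p) (hq : 0 < q) (hps : p < s) (hqt : q < t) :
    Hull p q s t = {z | 0 ≤ z.1 ∧ 0 ≤ z.2 ∧ 1 ≤ z.1 / p + z.2 / q ∧ z.1 / s + z.2 / t ≤ 1} := by
  have hs : 0 < s := hp.trans hps
  have ht : 0 < t := hq.trans hqt
  apply Set.Subset.antisymm
  · apply convexHull_min
    · have a1 : 1 ≤ s / p := by rw [le_div_iff₀ hp]; linarith
      have a2 : 1 ≤ t / q := by rw [le_div_iff₀ hq]; linarith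
      have a3 : p / s ≤ 1 := by rw [div_le_iff₀ hs]; linarith
      have a4 : q / t ≤ 1 := by rw [div_le_iff₀ ht]; linarith
      intro z hz
      simp only [Set.mem_insert_iff, Set.mem_singleton_iff] at hz
      rcases hz with rfl | rfl | rfl | rfl <;>
        simp [hp.le, hq.le, hs.le, ht.le, hp.ne', hq.ne', hs.ne', ht.ne', a1, a2, a3, a4]
    · rintro ⟨x, y⟩ ⟨h1, h2, h3, h4⟩ ⟨x', y'⟩ ⟨h1', h2', h3', h4'⟩ a b ha hb hab
      simp only at h1 h2 h3 h4 h1' h2' h3' h4'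
      simp only [Set.mem_setOf_eq, Prod.smul_mk, Prod.mk_add_mk, smul_eq_mul]
      refine ⟨by positivity, by positivity, ?_, ?_⟩
      · have : (a * x + b * x') / p + (a * y + b * y') / q
            = a * (x / p + y / q) + b * (x' / p + y' / q) := by ring
        rw [this]; nlinarith
      · have : (a * x + b * x') / s + (a * y + b * y') / t
            = a * (x / s + y / t) + b * (x' / s + y' / t) := by ring
        rw [this]; nlinarith
  · rintro ⟨x, y⟩ ⟨hx, hy, h3, h4⟩
    simp only at hx hy h3 h4
    obtain ⟨σ, hσ⟩ : ∃ σ, σ = x / p + y / q := ⟨_, rfl⟩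
    obtain ⟨τ, hτ⟩ : ∃ τ, τ = x / s + y / t := ⟨_, rfl⟩
    rw [← hσ] at h3
    rw [← hτ] at h4
    have hd : 0 < σ - τ := by
      have b1 : x / s ≤ x / p := by gcongr
      have b2 : y / t ≤ y / q := by gcongr
      rcases hx.eq_or_lt with rfl | hx'
      · rcases hy.eq_or_lt with rfl | hy'
        · simp at hσ; linarith
        · have : y / t < y / q := by gcongr
          linarith
      · have : x / s < x / p := by gcongr
        linarith
    have m1 : ((p, 0) : ℝ × ℝ) ∈ Hull p q s t := subset_convexHull _ _ (by simp)
    have m2 : ((s, 0) : ℝ × ℝ) ∈ Hull p q s t := subset_convexHull _ _ (by simp)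
    have m3 : ((0, q) : ℝ × ℝ) ∈ Hull p q s t := subset_convexHull _ _ (by simp)
    have m4 : ((0, t) : ℝ × ℝ) ∈ Hull p q s t := subset_convexHull _ _ (by simp)
    have hc : Convex ℝ (Hull p q s t) := convex_convexHull _ _
    have n1 : 0 ≤ 1 - τ := by linarith
    have n2 : 0 ≤ σ - 1 := by linarith
    have key := hc.sum_mem (t := Finset.univ)
      (w := ![(1 - τ) * (x / p) / (σ - τ), (σ - 1) * (x / s) / (σ - τ),
        (1 - τ) * (y / q) / (σ - τ), (σ - 1) * (y / t) / (σ - τ)])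
      (z := ![((p, 0) : ℝ × ℝ), (s, 0), (0, q), (0, t)])
      (by intro i _; fin_cases i <;> simp <;> positivity)
      (by
        simp only [Fin.sum_univ_four]
        simp
        rw [← add_div, ← add_div, ← add_div, div_eq_iff hd.ne']
        have : (1 - τ) * (x / p) + (σ - 1) * (x / s) + (1 - τ) * (y / q) + (σ - 1) * (y / t)
          = (1 - τ) * σ + (σ - 1) * τ := by rw [hσ, hτ]; ring
        rw [this]; ring)
      (by intro i _; fin_cases i <;> simp [m1, m2, m3, m4])
    convert key using 1
    simp only [Fin.sum_univ_four]
    ext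
    · simp
      field_simp
      ring
    · simp
      field_simp
      ring

lemma hull_union (p q m n s t : ℝ) (hp : 0 < p) (hq : 0 < q) (hpm : p < m) (hqn : q < n)
    (hms : m < s) (hnt : n < t) : Hull p q m n ∪ Hull m n s t = Hull p q s t := by
  have hm := hp.trans hpm
  have hn := hq.trans hqn
  rw [hull_eq p q m n hp hq hpm hqn, hull_eq m n s t hm hn hms hnt,
    hull_eq p q s t hp hq (hpm.trans hms) (hqn.trans hnt)]
  ext ⟨x, y⟩
  simp only [Set.mem_union, Set.mem_setOf_eq]
  constructor
  · rintro (⟨hx, hy, h3, h4⟩ | ⟨hx, hy, h3, h4⟩)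
    · refine ⟨hx, hy, h3, le_trans ?_ h4⟩
      gcongr
    · refine ⟨hx, hy, le_trans h3 ?_, h4⟩
      gcongr
  · rintro ⟨hx, hy, h3, h4⟩
    rcases le_total (x / m + y / n) 1 with h | h
    · exact Or.inl ⟨hx, hy, h3, h⟩
    · exact Or.inr ⟨hx, hy, h, h4⟩

lemma hull_disjoint (p q m n s t : ℝ) (hp : 0 < p) (hq : 0 < q) (hpm : p < m) (hqn : q < n)
    (hms : m < s) (hnt : n < t) :
    Disjoint (interior (Hull p q m n)) (interior (Hull m n s t)) := by
  have hm := hp.trans hpm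
  have hn := hq.trans hqn
  rw [Set.disjoint_left]
  rintro ⟨x, y⟩ h1 h2
  have hU : interior (Hull p q m n) ∩ interior (Hull m n s t) ∈ nhds ((x, y) : ℝ × ℝ) :=
    (isOpen_interior.inter isOpen_interior).mem_nhds ⟨h1, h2⟩
  have hline : ∀ z ∈ interior (Hull p q m n) ∩ interior (Hull m n s t),
      z.1 / m + z.2 / n = 1 := by
    rintro z ⟨hz1, hz2⟩
    have a := interior_subset hz1
    have b := interior_subset hz2
    rw [hull_eq p q m n hp hq hpm hqn] at a
    rw [hull_eq m n s t hm hn hms hnt] at b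
    exact le_antisymm a.2.2.2 b.2.2.1
  obtain ⟨ε, hε, hb⟩ := Metric.mem_nhds_iff.1 hU
  have k1 := hline (x, y) ⟨h1, h2⟩
  have k2 := hline (x + ε / 2, y) (hb (by
    simp [Prod.dist_eq, Real.dist_eq, abs_of_pos hε, hε]))
  simp only at k1 k2
  have : 0 < ε / 2 / m := by positivity
  rw [add_div] at k2
  linarith

/-- If `α₁β₂ < α₂β₁`, the quadrangle `Q(α₁β₂, α₂β₁)` admits a dissection into two
pieces, one affinely equivalent to `Q(α₁,β₁)` and the other to `Q(α₂,β₂)`. -/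
theorem Qab_div_Qab (α₁ β₁ α₂ β₂ : ℝ)
    (hα₁ : 0 < α₁) (hαβ₁ : α₁ < β₁) (hβ₁ : β₁ < 1)
    (hα₂ : 0 < α₂) (hαβ₂ : α₂ < β₂) (hβ₂ : β₂ < 1)
    (hlt : α₁ * β₂ < α₂ * β₁) :
    ∃ P₁ P₂ : Set (ℝ × ℝ),
      P₁ ∪ P₂ = Qab (α₁ * β₂) (α₂ * β₁) ∧
      Disjoint (interior P₁) (interior P₂) ∧
      AffineCopy (Qab α₁ β₁) P₁ ∧ AffineCopy (Qab α₂ β₂) P₂ := by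
  have h21 : α₂ * β₁ < 1 := by nlinarith
  have hβ₂0 : 0 < β₂ := hα₂.trans hαβ₂
  have hβ₁0 : 0 < β₁ := hα₁.trans hαβ₁
  have hp : 0 < α₁ * β₂ := by positivity
  have hq : 0 < α₂ * β₁ := by positivity
  have hpm : α₁ * β₂ < β₂ := by nlinarith
  have hqn : α₂ * β₁ < α₂ := by nlinarith
  have hα₂1 : α₂ < 1 := by linarith
  obtain ⟨ψ, hψ⟩ := hull_copy_Qab (α₁ * β₂) (α₂ * β₁) hp hlt h21
  refine ⟨ψ '' Hull (α₁ * β₂) (α₂ * β₁) β₂ α₂, ψ '' Hull β₂ α₂ 1 1, ?_, ?_, ?_, ?_⟩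
  · rw [← Set.image_union, hull_union _ _ _ _ _ _ hp hq hpm hqn hβ₂ hα₂1, hψ]
  · have hI : ∀ A : Set (ℝ × ℝ), interior (ψ '' A) = ψ '' interior A := fun A =>
      (ψ.toHomeomorphOfFiniteDimensional.image_interior A).symm
    rw [hI, hI, Set.disjoint_image_iff ψ.injective]
    exact hull_disjoint _ _ _ _ _ _ hp hq hpm hqn hβ₂ hα₂1
  · refine (hull_copy_Qab α₁ β₁ hα₁ hαβ₁ hβ₁).symm'.trans' (AffineCopy.trans' ?_ ⟨ψ, rfl⟩)
    have := hull_scale α₁ β₁ β₂ α₂ hβ₂0.ne' hα₂.ne'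
    rwa [mul_comm β₂ α₁] at this
  · exact (hull_copy_Qab α₂ β₂ hα₂ hαβ₂ hβ₂).symm'.trans'
      ((hull_swap α₂ β₂).trans' ⟨ψ, rfl⟩)
end

section
/- Let P be a convex quadrangle that admits a dissection into two pieces P₁ and P₂, where P₁ is a parallelogram (a convex quadrangle with both pairs of opposite sides parallel) and P₂ is a convex quadrangle. Then P₂ is a trapezoid and P is a trapezoid. -/
open Set

/-- A trapezoid is a convex quadrangle having at least one pair of parallel opposite
sides.  The vertices `a, b, c, d` are in cyclic order (expressed by the crossing of the
diagonals `ac` and `bd`), so the sides are `ab`, `bc`, `cd`, `da`, and a pair of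
opposite sides is parallel iff `c - d` is a multiple of `b - a` or `a - d` is a multiple
of `c - b`.  Parallelograms count as trapezoids. -/
def IsTrapezoid (Q : Set (ℝ × ℝ)) : Prop :=
  ∃ a b c d : ℝ × ℝ,
    Q = convexHull ℝ {a, b, c, d} ∧
    a ∉ convexHull ℝ ({b, c, d} : Set (ℝ × ℝ)) ∧
    b ∉ convexHull ℝ ({a, c, d} : Set (ℝ × ℝ)) ∧
    c ∉ convexHull ℝ ({a, b, d} : Set (ℝ × ℝ)) ∧
    d ∉ convexHull ℝ ({a, b, c} : Set (ℝ × ℝ)) ∧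
    (segment ℝ a c ∩ segment ℝ b d).Nonempty ∧
    ((∃ t : ℝ, c - d = t • (b - a)) ∨ (∃ t : ℝ, a - d = t • (c - b)))

/-- A parallelogram is a convex quadrangle (vertices in cyclic order, expressed by the
crossing of the diagonals) with both pairs of opposite sides parallel. -/
def IsParallelogram (Q : Set (ℝ × ℝ)) : Prop :=
  ∃ a b c d : ℝ × ℝ,
    Q = convexHull ℝ {a, b, c, d} ∧
    a ∉ convexHull ℝ ({b, c, d} : Set (ℝ × ℝ)) ∧
    b ∉ convexHull ℝ ({a, c, d} : Set (ℝ × ℝ)) ∧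
    c ∉ convexHull ℝ ({a, b, d} : Set (ℝ × ℝ)) ∧
    d ∉ convexHull ℝ ({a, b, c} : Set (ℝ × ℝ)) ∧
    (segment ℝ a c ∩ segment ℝ b d).Nonempty ∧
    (∃ t : ℝ, c - d = t • (b - a)) ∧ (∃ t : ℝ, a - d = t • (c - b))

lemma ext_of_notMem {a : ℝ × ℝ} {S : Set (ℝ × ℝ)} (hS : S.Nonempty) (h : a ∉ convexHull ℝ S) :
    a ∈ (convexHull ℝ (insert a S)).extremePoints ℝ := by
  rw [mem_extremePoints_iff_left]
  refine ⟨subset_convexHull _ _ (by simp), ?_⟩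
  rw [convexHull_insert hS]
  intro x hx y hy hxy
  rw [mem_convexJoin] at hx hy
  obtain ⟨a1, ha1, x', hx', hx⟩ := hx
  obtain ⟨a2, ha2, y', hy', hy⟩ := hy
  rw [mem_singleton_iff] at ha1 ha2
  rw [ha1] at hx
  rw [ha2] at hy
  obtain ⟨s', s, hs', hs, hss, rfl⟩ := hx
  obtain ⟨t', t, ht', ht, htt, rfl⟩ := hy
  obtain ⟨p, q, hp, hq, hpq, hh⟩ := hxy
  rcases eq_or_lt_of_le hs with hs0 | hs0
  · have : s' = 1 := by linarith
    rw [← hs0, this]; simp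
  · exfalso
    apply h
    have hpos : 0 < p * s + q * t := by positivity
    have hs2 : s' = 1 - s := by linarith
    have ht2 : t' = 1 - t := by linarith
    have hq2 : q = 1 - p := by linarith
    have e : a = (p * s / (p * s + q * t)) • x' + (q * t / (p * s + q * t)) • y' := by
      have e1 : (p * s + q * t) • a = (p * s) • x' + (q * t) • y' := by
        have e0 : a - (p • (s' • a + s • x') + q • (t' • a + t • y')) = 0 := by rw [hh, sub_self]
        have e2 : (p * s + q * t) • a - ((p * s) • x' + (q * t) • y')
            = a - (p • (s' • a + s • x') + q • (t' • a + t • y')) := by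
          rw [hs2, ht2, hq2]; module
        rw [← sub_eq_zero, e2, e0]
      rw [div_eq_inv_mul, div_eq_inv_mul, mul_smul _ (p * s), mul_smul _ (q * t), ← smul_add,
        ← e1, smul_smul, inv_mul_cancel₀ hpos.ne', one_smul]
    rw [e]
    exact convex_convexHull ℝ S hx' hy' (by positivity) (by positivity) (by field_simp)

lemma hull4 {a b c d x : ℝ × ℝ} (h : x ∈ convexHull ℝ ({a, b, c, d} : Set (ℝ × ℝ))) :
    ∃ p q r s : ℝ, 0 ≤ p ∧ 0 ≤ q ∧ 0 ≤ r ∧ 0 ≤ s ∧ p + q + r + s = 1 ∧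
      x = p • a + q • b + r • c + s • d := by
  rw [convexHull_insert (by simp), mem_convexJoin] at h
  obtain ⟨a', ha', y, hy, h⟩ := h
  rw [convexHull_insert (by simp), mem_convexJoin] at hy
  obtain ⟨b', hb', z, hz, hy⟩ := hy
  rw [convexHull_pair] at hz
  simp only [mem_singleton_iff] at ha' hb'
  subst ha' hb'
  obtain ⟨p, q, hp, hq, hpq, rfl⟩ := hz
  obtain ⟨p', q', hp', hq', hpq', rfl⟩ := hy
  obtain ⟨p2, q2, hp2, hq2, hpq2, rfl⟩ := h
  refine ⟨p2, q2 * p', q2 * q' * p, q2 * q' * q, hp2, by positivity, by positivity, by positivity, ?_, by module⟩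
  linear_combination hpq2 + q2 * hpq' + q2 * q' * hpq

lemma ext_not_collinear {A : Set (ℝ × ℝ)} {x y z : ℝ × ℝ}
    (hx : x ∈ A.extremePoints ℝ) (hy : y ∈ A.extremePoints ℝ) (hz : z ∈ A.extremePoints ℝ)
    (hxy : x ≠ y) (hyz : y ≠ z) (hxz : x ≠ z) : ¬ Collinear ℝ ({x, y, z} : Set (ℝ × ℝ)) := by
  intro hc
  have key : ∀ p q r : ℝ × ℝ, p ∈ A.extremePoints ℝ → q ∈ A.extremePoints ℝ →
      r ∈ A.extremePoints ℝ → p ≠ q → q ≠ r → Wbtw ℝ p q r → False := by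
    intro p q r hp hq hr h1 h2 h
    rw [mem_extremePoints] at hq
    have := hq.2 p hp.1 r hr.1 (by
      have h' := h.mem_segment
      rw [← insert_endpoints_openSegment] at h'
      rcases h' with h' | h' | h'
      · exact absurd h'.symm h1
      · exact absurd h' h2
      · exact h')
    exact h1 this.1
  rcases hc.wbtw_or_wbtw_or_wbtw with h | h | h
  · exact key _ _ _ hx hy hz hxy hyz h
  · exact key _ _ _ hy hz hx hyz hxz.symm h
  · exact key _ _ _ hz hx hy hxz.symm hxy h

lemma line_ext {A : Set (ℝ × ℝ)} (f : ℝ × ℝ →L[ℝ] ℝ) (hf : f ≠ 0) {u : ℝ} {x y z : ℝ × ℝ}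
    (hx : x ∈ A.extremePoints ℝ) (hy : y ∈ A.extremePoints ℝ) (hz : z ∈ A.extremePoints ℝ)
    (fx : f x = u) (fy : f y = u) (fz : f z = u) (hxy : x ≠ y) (hyz : y ≠ z) (hxz : x ≠ z) :
    False := by
  have hc : Collinear ℝ ({x, y, z} : Set (ℝ × ℝ)) := by
    rw [collinear_iff_of_mem (p₀ := x) (by simp)]
    have hlin : ∀ v : ℝ × ℝ, f v = v.1 * f (1, 0) + v.2 * f (0, 1) := by
      intro v
      have : v = v.1 • ((1, 0) : ℝ × ℝ) + v.2 • ((0, 1) : ℝ × ℝ) := by ext <;> simp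
      calc f v = f (v.1 • ((1, 0) : ℝ × ℝ) + v.2 • ((0, 1) : ℝ × ℝ)) := by rw [← this]
        _ = _ := by rw [map_add, map_smul, map_smul, smul_eq_mul, smul_eq_mul]
    set α := f (1, 0)
    set β := f (0, 1)
    have hne : α ^ 2 + β ^ 2 ≠ 0 := by
      intro h
      apply hf
      have h1 : α = 0 := by nlinarith [sq_nonneg α, sq_nonneg β]
      have h2 : β = 0 := by nlinarith [sq_nonneg α, sq_nonneg β]
      ext <;> simp [hlin, h1, h2]
    refine ⟨(-β, α), ?_⟩
    have : ∀ p : ℝ × ℝ, f p = u → ∃ r : ℝ, p = r • ((-β, α) : ℝ × ℝ) +ᵥ x := by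
      intro p hp
      rw [hlin] at hp fx
      refine ⟨((p.2 - x.2) * α - (p.1 - x.1) * β) / (α ^ 2 + β ^ 2), ?_⟩
      ext <;> simp <;> field_simp
      · linear_combination α * (hp - fx)
      · linear_combination β * (hp - fx)
    intro p hp
    simp only [mem_insert_iff, mem_singleton_iff] at hp
    rcases hp with rfl | rfl | rfl <;> exact this _ (by assumption)
  exact ext_not_collinear hx hy hz hxy hyz hxz hc

lemma side_ext {A B : Set (ℝ × ℝ)} (f : ℝ × ℝ →L[ℝ] ℝ) {u : ℝ}
    (hB : ∀ x ∈ B, u ≤ f x) (hc : Convex ℝ (A ∪ B)) {v : ℝ × ℝ}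
    (hv : v ∈ A.extremePoints ℝ) (hfv : f v < u) : v ∈ (A ∪ B).extremePoints ℝ := by
  rw [mem_extremePoints_iff_left] at hv ⊢
  refine ⟨Or.inl hv.1, ?_⟩
  intro x hx y hy h
  have hin : ∀ z ∈ A ∪ B, f z < u → z ∈ A := by
    rintro z (hz | hz) h
    · exact hz
    · exact absurd h (not_lt.2 (hB z hz))
  obtain ⟨p, q, hp, hq, hpq, hvv⟩ := h
  -- shrink towards v
  have hcont : ∀ z : ℝ × ℝ, ∃ e : ℝ, 0 < e ∧ e < 1 ∧ ∀ t, 0 < t → t ≤ e → f (v + t • (z - v)) < u := by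
    intro z
    refine ⟨(u - f v) / (2 * (u - f v) + |f z - f v|), by have := abs_nonneg (f z - f v); apply div_pos <;> linarith, ?_, ?_⟩
    · rw [div_lt_one] <;> linarith [abs_nonneg (f z - f v)]
    · intro t ht hte
      rw [le_div_iff₀ (by linarith [abs_nonneg (f z - f v)])] at hte
      simp only [map_add, map_smul, map_sub, smul_eq_mul]
      nlinarith [le_abs_self (f z - f v), mul_pos ht (sub_pos.2 hfv)]
  obtain ⟨e1, h1, h1', H1⟩ := hcont x
  obtain ⟨e2, h2, h2', H2⟩ := hcont y
  have hvAB : v ∈ A ∪ B := Or.inl hv.1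
  set e := min e1 e2
  have he : 0 < e := lt_min h1 h2
  have he1 : e ≤ e1 := min_le_left _ _
  have he2 : e ≤ e2 := min_le_right _ _
  have hx' : v + e • (x - v) ∈ A := hin _ (hc.add_smul_sub_mem hvAB hx ⟨he.le, by linarith⟩) (H1 e he he1)
  have hy' : v + e • (y - v) ∈ A := hin _ (hc.add_smul_sub_mem hvAB hy ⟨he.le, by linarith⟩) (H2 e he he2)
  have := hv.2 _ hx' _ hy' ⟨p, q, hp, hq, hpq, by
    have hq' : q = 1 - p := by linarith
    subst hq'
    rw [← hvv]; module⟩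
  have h3 : e • (x - v) = 0 := by simpa using this
  rcases smul_eq_zero.1 h3 with h | h
  · exact absurd h he.ne'
  · exact sub_eq_zero.1 h

lemma side_mem {A B : Set (ℝ × ℝ)} (f : ℝ × ℝ →L[ℝ] ℝ) {u : ℝ}
    (hB : ∀ x ∈ B, u ≤ f x) (hc : Convex ℝ (A ∪ B)) (hcl : IsClosed A)
    {y : ℝ × ℝ} (hy : y ∈ A) (hfy : f y < u) {x : ℝ × ℝ} (hx : x ∈ A ∪ B) (hfx : f x = u) :
    x ∈ A := by
  have hin : ∀ z ∈ A ∪ B, f z < u → z ∈ A := by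
    rintro z (hz | hz) h
    · exact hz
    · exact absurd h (not_lt.2 (hB z hz))
  have hlim : Filter.Tendsto (fun n : ℕ => x + (1 / ((n : ℝ) + 1)) • (y - x)) Filter.atTop
      (nhds (x + (0 : ℝ) • (y - x))) :=
    tendsto_const_nhds.add (tendsto_one_div_add_atTop_nhds_zero_nat.smul_const _)
  rw [zero_smul, add_zero] at hlim
  refine hcl.mem_of_tendsto hlim (Filter.Eventually.of_forall fun n => ?_)
  have hn : (0 : ℝ) < 1 / ((n : ℝ) + 1) := by positivity
  have hn1 : 1 / ((n : ℝ) + 1) ≤ 1 := by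
    rw [div_le_one (by positivity)]; linarith [Nat.cast_nonneg (α := ℝ) n]
  apply hin _ (hc.add_smul_sub_mem hx (Or.inl hy) ⟨hn.le, hn1⟩)
  simp only [map_add, map_smul, map_sub, smul_eq_mul]
  nlinarith

lemma face_ext {A B : Set (ℝ × ℝ)} (f : ℝ × ℝ →L[ℝ] ℝ) {u : ℝ}
    (hB : ∀ x ∈ B, u ≤ f x) (hBA : ∀ x ∈ B, f x = u → x ∈ A) (hAB : ∀ x ∈ A, f x = u → x ∈ B)
    {v : ℝ × ℝ} (hv : v ∈ A.extremePoints ℝ) (hfv : f v = u) : v ∈ B.extremePoints ℝ := by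
  rw [mem_extremePoints_iff_left] at hv ⊢
  refine ⟨hAB v hv.1 hfv, ?_⟩
  intro x hx y hy h
  have h' := h
  obtain ⟨p, q, hp, hq, hpq, rfl⟩ := h
  simp only [map_add, map_smul, smul_eq_mul] at hfv
  have hx1 := hB x hx
  have hy1 := hB y hy
  have hq' : q = 1 - p := by linarith
  subst hq'
  have e1 : f x = u := by
    by_contra hne
    have : u < f x := lt_of_le_of_ne hx1 (Ne.symm hne)
    nlinarith
  have e2 : f y = u := by
    by_contra hne
    have : u < f y := lt_of_le_of_ne hy1 (Ne.symm hne)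
    nlinarith
  exact hv.2 _ (hBA x hx e1) _ (hBA y hy e2) h'

lemma trap_mk {Q : Set (ℝ × ℝ)} {a b s r w : ℝ × ℝ} {R S : ℝ}
    (hQ : Q = convexHull ℝ {a, b, s, r}) (hE : Q.extremePoints ℝ = {a, b, s, r})
    (h1 : a ≠ b) (h2 : a ≠ s) (h3 : a ≠ r) (h4 : b ≠ s) (h5 : b ≠ r) (h6 : s ≠ r)
    (hR : 0 < R) (hS : 0 < S) (hr : r = a + R • w) (hs : s = b + S • w) : IsTrapezoid Q := by
  have key : ∀ (x : ℝ × ℝ) (T : Set (ℝ × ℝ)), x ∉ T → insert x T = ({a, b, s, r} : Set (ℝ × ℝ)) →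
      x ∉ convexHull ℝ T := by
    intro x T hxT hT hx
    have e1 : Q = convexHull ℝ T := by
      rw [hQ, ← hT]
      apply subset_antisymm
      · exact convexHull_min (insert_subset hx (subset_convexHull _ _)) (convex_convexHull _ _)
      · exact convexHull_mono (subset_insert _ _)
    have : x ∈ Q.extremePoints ℝ := by rw [hE, ← hT]; simp
    rw [e1] at this
    exact hxT (extremePoints_convexHull_subset this)
  refine ⟨a, b, s, r, hQ, key _ _ (by simp [h1, h2, h3]) rfl, key _ _ ?_ ?_, key _ _ ?_ ?_, key _ _ ?_ ?_, ?_, ?_⟩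
  · simp only [mem_insert_iff, mem_singleton_iff, not_or]; exact ⟨h1.symm, h4, h5⟩
  · ext; simp; tauto
  · simp only [mem_insert_iff, mem_singleton_iff, not_or]; exact ⟨h2.symm, h4.symm, h6⟩
  · ext; simp; tauto
  · simp only [mem_insert_iff, mem_singleton_iff, not_or]; exact ⟨h3.symm, h5.symm, h6.symm⟩
  · ext; simp; tauto
  · have hRS : R + S ≠ 0 := by positivity
    refine ⟨(S / (R + S)) • a + (R / (R + S)) • s, ⟨_, _, by positivity, by positivity, by field_simp; ring, rfl⟩,
      ⟨R / (R + S), S / (R + S), by positivity, by positivity, by field_simp, ?_⟩⟩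
    rw [hs, hr]
    ext <;> simp <;> field_simp <;> ring
  · right
    have : S ≠ 0 := hS.ne'
    refine ⟨-(R / S), ?_⟩
    rw [hr, hs]
    ext <;> simp <;> field_simp

lemma quad_facts {Q : Set (ℝ × ℝ)} {a b c d : ℝ × ℝ} (hQ : Q = convexHull ℝ {a, b, c, d})
    (ha : a ∉ convexHull ℝ ({b, c, d} : Set (ℝ × ℝ)))
    (hb : b ∉ convexHull ℝ ({a, c, d} : Set (ℝ × ℝ)))
    (hc : c ∉ convexHull ℝ ({a, b, d} : Set (ℝ × ℝ)))
    (hd : d ∉ convexHull ℝ ({a, b, c} : Set (ℝ × ℝ))) :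
    Q.extremePoints ℝ = {a, b, c, d} ∧ (a ≠ b ∧ a ≠ c ∧ a ≠ d ∧ b ≠ c ∧ b ≠ d ∧ c ≠ d) ∧
      (interior Q).Nonempty := by
  have ne : ∀ {x : ℝ × ℝ} {S : Set (ℝ × ℝ)}, x ∉ convexHull ℝ S → ∀ y ∈ S, x ≠ y := by
    rintro x S hx y hy rfl
    exact hx (subset_convexHull _ _ hy)
  have key : ∀ (x : ℝ × ℝ) (T : Set (ℝ × ℝ)), T.Nonempty → x ∉ convexHull ℝ T →
      insert x T = ({a, b, c, d} : Set (ℝ × ℝ)) → x ∈ Q.extremePoints ℝ := by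
    intro x T hT hx h
    rw [hQ, ← h]
    exact ext_of_notMem hT hx
  have Ea := key a _ (by simp) ha rfl
  have Eb := key b _ (by simp) hb (by ext; simp; tauto)
  have Ec := key c _ (by simp) hc (by ext; simp; tauto)
  have Ed := key d _ (by simp) hd (by ext; simp; tauto)
  have hab := ne ha b (by simp)
  have hac := ne ha c (by simp)
  have hbc := ne hb c (by simp)
  refine ⟨?_, ⟨hab, hac, ne ha d (by simp), hbc, ne hb d (by simp),
    ne hc d (by simp)⟩, ?_⟩
  · apply subset_antisymm
    · rw [hQ]; exact extremePoints_convexHull_subset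
    · intro x hx
      simp only [mem_insert_iff, mem_singleton_iff] at hx
      rcases hx with rfl | rfl | rfl | rfl <;> assumption
  · have h1 := ext_not_collinear Ea Eb Ec hab hbc hac
    rw [← affineIndependent_iff_not_collinear_set] at h1
    have h2 := h1.affineSpan_eq_top_iff_card_eq_finrank_add_one.2 (by simp)
    rw [hQ, interior_convexHull_nonempty_iff_affineSpan_eq_top, eq_top_iff, ← h2]
    apply affineSpan_mono
    rintro _ ⟨i, rfl⟩
    fin_cases i <;> simp

set_option maxHeartbeats 1000000 in
lemma fin_trap {P P₁ P₂ : Set (ℝ × ℝ)} {a b c d r s : ℝ × ℝ} (f : ℝ × ℝ →L[ℝ] ℝ) {u : ℝ}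
    (hseg : ∀ x ∈ P, f x = u → x ∈ P₁) (hcP : c ∈ P) (hdP : d ∈ P)
    (hP : P = convexHull ℝ {a, b, r, s}) (hP₁ : P₁ = convexHull ℝ {a, b, c, d})
    (hP₂ : P₂ = convexHull ℝ {c, d, r, s})
    (hE : P.extremePoints ℝ = {a, b, r, s}) (hE₂ : P₂.extremePoints ℝ = {c, d, r, s})
    (hpar : c - d = b - a) (fa : f a < u) (fb : f b < u) (fc : f c = u) (fd : f d = u)
    (fr : u < f r) (fs : u < f s) (hcd : c ≠ d) (hrs : r ≠ s) :
    IsTrapezoid P₂ ∧ IsTrapezoid P := by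
  have hlin : ∀ v : ℝ × ℝ, f v = v.1 * f (1, 0) + v.2 * f (0, 1) := by
    intro v
    have : v = v.1 • ((1, 0) : ℝ × ℝ) + v.2 • ((0, 1) : ℝ × ℝ) := by ext <;> simp
    calc f v = f (v.1 • ((1, 0) : ℝ × ℝ) + v.2 • ((0, 1) : ℝ × ℝ)) := by rw [← this]
      _ = _ := by rw [map_add, map_smul, map_smul, smul_eq_mul, smul_eq_mul]
  have hb : b = a + (c - d) := by rw [hpar]; abel
  set w := d - a with hw
  set e := c - d with he
  have fw : 0 < f w := by rw [hw, map_sub]; linarith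
  have fe : f e = 0 := by rw [he, map_sub]; linarith
  have e0 : e ≠ 0 := sub_ne_zero.2 hcd
  have hda : d = a + w := by rw [hw]; abel
  have hcb : c = b + w := by rw [hb, hw, he]; abel
  -- every vector is a combination of `e` and `w`
  have hD : w.1 * e.2 - w.2 * e.1 ≠ 0 := by
    intro hD
    apply e0
    rw [hlin] at fe fw
    have h1 : e.1 * (w.1 * f (1, 0) + w.2 * f (0, 1)) = 0 := by
      linear_combination w.1 * fe - f (0, 1) * hD
    have h2 : e.2 * (w.1 * f (1, 0) + w.2 * f (0, 1)) = 0 := by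
      linear_combination w.2 * fe + f (1, 0) * hD
    ext
    · exact (mul_eq_zero.1 h1).resolve_right fw.ne'
    · exact (mul_eq_zero.1 h2).resolve_right fw.ne'
  have hcoord : ∀ x : ℝ × ℝ, ∃ p q : ℝ, x = d + p • e + q • w := by
    intro x
    refine ⟨(w.1 * (x - d).2 - w.2 * (x - d).1) / (w.1 * e.2 - w.2 * e.1),
      ((x - d).1 * e.2 - (x - d).2 * e.1) / (w.1 * e.2 - w.2 * e.1), ?_⟩
    ext <;> simp <;> field_simp <;> ring
  have huniq : ∀ p q p' q' : ℝ, d + p • e + q • w = d + p' • e + q' • w → p = p' ∧ q = q' := by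
    intro p q p' q' h
    have h1 := congrArg Prod.fst h
    have h2 := congrArg Prod.snd h
    simp at h1 h2
    constructor
    · apply mul_right_cancel₀ hD; linear_combination w.1 * h2 - w.2 * h1
    · apply mul_right_cancel₀ hD; linear_combination e.2 * h1 - e.1 * h2
  have hfc : ∀ p q : ℝ, f (d + p • e + q • w) = u + q * f w := by
    intro p q
    simp [fe, fd]
  have ha' : a = d + (0:ℝ) • e + (-1:ℝ) • w := by rw [hda]; module
  have hb' : b = d + (1:ℝ) • e + (-1:ℝ) • w := by rw [hb, hda]; module
  have hd' : d = d + (0:ℝ) • e + (0:ℝ) • w := by module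
  have hc' : c = d + (1:ℝ) • e + (0:ℝ) • w := by rw [he]; module
  have hbound : ∀ p q : ℝ, d + p • e + q • w ∈ P₁ → 0 ≤ p ∧ p ≤ 1 := by
    intro p q h
    rw [hP₁] at h
    obtain ⟨k, l, m, n, hk, hl, hm, hn, hsum, h⟩ := hull4 h
    have : d + p • e + q • w = d + (l + m) • e + (- k - l) • w := by
      rw [h]
      have hk' : k = 1 - l - m - n := by linarith
      conv_lhs => rw [ha', hb', hc']
      rw [hk']; module
    have := (huniq _ _ _ _ this).1
    constructor <;> linarith
  have hbd : ∀ t p q : ℝ, d + t • e + (-1:ℝ) • w ∈ P → d + p • e + q • w ∈ P → 0 < q →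
      0 ≤ (q * t + p) ∧ (q * t + p) ≤ q + 1 := by
    intro t p q h1 h2 hq
    have hconv : Convex ℝ P := by rw [hP]; exact convex_convexHull _ _
    have hz : d + ((q * t + p) / (q + 1)) • e + (0:ℝ) • w ∈ P := by
      have := hconv h1 h2 (a := q / (q + 1)) (b := 1 / (q + 1)) (by positivity) (by positivity)
        (by field_simp)
      convert this using 1
      ext <;> simp <;> field_simp <;> ring
    have h3 := hbound _ _ (hseg _ hz (by rw [hfc]; ring))
    rw [le_div_iff₀ (by positivity), div_le_iff₀ (by positivity)] at h3
    constructor <;> linarith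
  have haP : a ∈ P := by rw [hP]; exact subset_convexHull _ _ (by simp)
  have hbP : b ∈ P := by rw [hP]; exact subset_convexHull _ _ (by simp)
  have hrP : r ∈ P := by rw [hP]; exact subset_convexHull _ _ (by simp)
  have hsP : s ∈ P := by rw [hP]; exact subset_convexHull _ _ (by simp)
  obtain ⟨p₁, q₁, hr⟩ := hcoord r
  obtain ⟨p₂, q₂, hs⟩ := hcoord s
  have hq₁ : 0 < q₁ := by
    rw [hr, hfc] at fr
    by_contra h
    nlinarith
  have hq₂ : 0 < q₂ := by
    rw [hs, hfc] at fs
    by_contra h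
    nlinarith
  have r1 := (hbd 0 p₁ q₁ (ha' ▸ haP) (hr ▸ hrP) hq₁).1
  have r2 := (hbd 1 p₁ q₁ (hb' ▸ hbP) (hr ▸ hrP) hq₁).2
  have s1 := (hbd 0 p₂ q₂ (ha' ▸ haP) (hs ▸ hsP) hq₂).1
  have s2 := (hbd 1 p₂ q₂ (hb' ▸ hbP) (hs ▸ hsP) hq₂).2
  have hcomb : ∀ x y : ℝ, d + x • e + y • w ∈ P → ∃ k l m n : ℝ, 0 ≤ k ∧ 0 ≤ l ∧ 0 ≤ m ∧ 0 ≤ n ∧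
      k + l + m + n = 1 ∧ x = l + m * p₁ + n * p₂ ∧ y = - k - l + m * q₁ + n * q₂ := by
    intro x y h
    rw [hP] at h
    obtain ⟨k, l, m, n, hk, hl, hm, hn, hsum, h⟩ := hull4 h
    have : d + x • e + y • w = d + (l + m * p₁ + n * p₂) • e + (- k - l + m * q₁ + n * q₂) • w := by
      rw [h]
      have hk' : k = 1 - l - m - n := by linarith
      conv_lhs => rw [ha', hb', hr, hs]
      rw [hk']; module
    obtain ⟨h1, h2⟩ := huniq _ _ _ _ this
    exact ⟨k, l, m, n, hk, hl, hm, hn, hsum, h1, h2⟩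
  have hone : p₁ = 1 ∨ p₂ = 1 := by
    obtain ⟨k, l, m, n, hk, hl, hm, hn, hsum, h1, h2⟩ := hcomb 1 0 (hc' ▸ hcP)
    by_contra! hcon
    have k1 : p₁ < 1 := lt_of_le_of_ne (by linarith) hcon.1
    have k2 : p₂ < 1 := lt_of_le_of_ne (by linarith) hcon.2
    have i1 : 0 ≤ m * (1 - p₁) := mul_nonneg hm (by linarith)
    have i2 : 0 ≤ n * (1 - p₂) := mul_nonneg hn (by linarith)
    have m0 : m = 0 := by
      have : m * (1 - p₁) = 0 := by linarith
      exact (mul_eq_zero.1 this).resolve_right (by linarith)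
    have n0 : n = 0 := by
      have : n * (1 - p₂) = 0 := by linarith
      exact (mul_eq_zero.1 this).resolve_right (by linarith)
    subst m0 n0
    linarith
  have hzero : p₁ = 0 ∨ p₂ = 0 := by
    obtain ⟨k, l, m, n, hk, hl, hm, hn, hsum, h1, h2⟩ := hcomb 0 0 (hd' ▸ hdP)
    by_contra! hcon
    have k1 : 0 < p₁ := lt_of_le_of_ne (by linarith) hcon.1.symm
    have k2 : 0 < p₂ := lt_of_le_of_ne (by linarith) hcon.2.symm
    have i1 : 0 ≤ m * p₁ := mul_nonneg hm (by linarith)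
    have i2 : 0 ≤ n * p₂ := mul_nonneg hn (by linarith)
    have m0 : m = 0 := by
      have : m * p₁ = 0 := by linarith
      exact (mul_eq_zero.1 this).resolve_right (by linarith)
    have n0 : n = 0 := by
      have : n * p₂ = 0 := by linarith
      exact (mul_eq_zero.1 this).resolve_right (by linarith)
    subst m0 n0
    linarith
  have hne : ∀ {x y : ℝ × ℝ}, f x < f y → x ≠ y := by
    rintro x y h rfl; exact lt_irrefl _ h
  have hab : a ≠ b := by
    intro h
    rw [h, sub_self] at hpar
    exact e0 hpar
  have har : a ≠ r := hne (by linarith)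
  have has : a ≠ s := hne (by linarith)
  have hbr : b ≠ r := hne (by linarith)
  have hbs : b ≠ s := hne (by linarith)
  have hcr : c ≠ r := hne (by linarith)
  have hcs : c ≠ s := hne (by linarith)
  have hdr : d ≠ r := hne (by linarith)
  have hds : d ≠ s := hne (by linarith)
  have hcase : (p₁ = 0 ∧ p₂ = 1) ∨ (p₁ = 1 ∧ p₂ = 0) := by
    rcases hone with h | h <;> rcases hzero with h' | h'
    · linarith
    · right; exact ⟨h, h'⟩
    · left; exact ⟨h', h⟩
    · linarith
  have t1 : ({d, c, s, r} : Set (ℝ × ℝ)) = {c, d, r, s} := by ext; simp; tauto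
  have t2 : ({d, c, r, s} : Set (ℝ × ℝ)) = {c, d, r, s} := by ext; simp; tauto
  have t3 : ({a, b, s, r} : Set (ℝ × ℝ)) = {a, b, r, s} := by ext; simp; tauto
  rcases hcase with ⟨z1, z2⟩ | ⟨z1, z2⟩
  · rw [z1] at hr
    rw [z2] at hs
    have r' : r = d + q₁ • w := by rw [hr]; module
    have s' : s = c + q₂ • w := by rw [hs]; conv_rhs => rw [hc']
                                   module
    constructor
    · exact trap_mk (a := d) (b := c) (s := s) (r := r) (by rw [t1]; exact hP₂)
        (by rw [t1]; exact hE₂) hcd.symm hds hdr hcs hcr hrs.symm hq₁ hq₂ r' s'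
    · refine trap_mk (a := a) (b := b) (s := s) (r := r) (R := q₁ + 1) (S := q₂ + 1) (w := w)
        (by rw [t3]; exact hP)
        (by rw [t3]; exact hE) hab has har hbs hbr hrs.symm (by positivity) (by positivity) ?_ ?_
      · rw [r']; conv_lhs => rw [hda]
        module
      · rw [s', hcb]; module
  · rw [z1] at hr
    rw [z2] at hs
    have s' : s = d + q₂ • w := by rw [hs]; module
    have r' : r = c + q₁ • w := by rw [hr]; conv_rhs => rw [hc']
                                   module
    constructor
    · exact trap_mk (a := d) (b := c) (s := r) (r := s) (by rw [t2]; exact hP₂)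
        (by rw [t2]; exact hE₂) hcd.symm hdr hds hcr hcs hrs hq₂ hq₁ s' r'
    · refine trap_mk (a := a) (b := b) (s := r) (r := s) (R := q₂ + 1) (S := q₁ + 1) (w := w)
        hP hE hab har has hbr hbs hrs (by positivity) (by positivity) ?_ ?_
      · rw [s']; conv_lhs => rw [hda]
        module
      · rw [r', hcb]; module

lemma card_line {A : Set (ℝ × ℝ)} (f : ℝ × ℝ →L[ℝ] ℝ) (hf : f ≠ 0) {u : ℝ}
    {T : Finset (ℝ × ℝ)} (hT : ∀ x ∈ T, x ∈ A.extremePoints ℝ ∧ f x = u) : T.card ≤ 2 := by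
  by_contra h
  obtain ⟨x, hx, y, hy, z, hz, hxy, hxz, hyz⟩ := Finset.two_lt_card.1 (not_le.1 h)
  exact line_ext f hf (hT x hx).1 (hT y hy).1 (hT z hz).1 (hT x hx).2 (hT y hy).2 (hT z hz).2
    hxy hyz hxz

lemma quad_finset {Q : Set (ℝ × ℝ)} (h : IsConvexQuadrangle Q) :
    ∃ F : Finset (ℝ × ℝ), F.card = 4 ∧ (∀ x, x ∈ Q.extremePoints ℝ ↔ x ∈ F) ∧
      Q = convexHull ℝ (Q.extremePoints ℝ) ∧ (interior Q).Nonempty ∧ IsClosed Q ∧ Convex ℝ Q := by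
  classical
  obtain ⟨a, b, c, d, hQ, ha, hb, hc, hd⟩ := h
  obtain ⟨hE, ⟨h1, h2, h3, h4, h5, h6⟩, hi⟩ := quad_facts hQ ha hb hc hd
  refine ⟨{a, b, c, d}, ?_, ?_, ?_, hi, ?_, ?_⟩
  · rw [Finset.card_eq_of_equiv_fin]
    exact Fintype.equivFinOfCardEq (by simp [h1, h2, h3, h4, h5, h6])
  · intro x; rw [hE]; simp
  · rw [hE]; exact hQ
  · rw [hQ]; exact (Set.Finite.isCompact_convexHull ℝ (Set.toFinite _)).isClosed
  · rw [hQ]; exact convex_convexHull _ _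

/-- If a convex quadrangle `P` is dissected into a parallelogram `P₁` and a convex
quadrangle `P₂`, then `P₂` is a trapezoid and `P` is a trapezoid. -/
theorem parallelogram_piece_forces_trapezoid (P P₁ P₂ : Set (ℝ × ℝ))
    (hP : IsConvexQuadrangle P) (hP₁ : IsParallelogram P₁) (hP₂ : IsConvexQuadrangle P₂)
    (hunion : P₁ ∪ P₂ = P) (hdisj : Disjoint (interior P₁) (interior P₂)) :
    IsTrapezoid P₂ ∧ IsTrapezoid P := by
  classical
  obtain ⟨F, hF4, hF, hPh, -, -, hPc⟩ := quad_finset hP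
  obtain ⟨F₂, hF24, hF2, hP2h, hi2, hcl2, hc2⟩ := quad_finset hP₂
  obtain ⟨a, b, c, d, hQ, ha, hb, hc, hd, -, ⟨t, ht⟩, ⟨t', ht'⟩⟩ := hP₁
  obtain ⟨F₁, hF14, hF1, hP1h, hi1, hcl1, hc1⟩ := quad_finset ⟨a, b, c, d, hQ, ha, hb, hc, hd⟩
  obtain ⟨hE, ⟨n1, n2, n3, n4, n5, n6⟩, -⟩ := quad_facts hQ ha hb hc hd
  have Ea : a ∈ P₁.extremePoints ℝ := by rw [hE]; simp
  have Eb : b ∈ P₁.extremePoints ℝ := by rw [hE]; simp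
  have Ec : c ∈ P₁.extremePoints ℝ := by rw [hE]; simp
  have Ed : d ∈ P₁.extremePoints ℝ := by rw [hE]; simp
  -- the parallelogram law
  have hpar : c - d = b - a := by
    by_cases h1 : t = 1
    · rw [ht, h1, one_smul]
    · exfalso
      apply ext_not_collinear Eb Ec Ea n4 n2.symm n1.symm
      rw [collinear_iff_of_mem (p₀ := b) (by simp)]
      have hk : (t - 1) • (b - a) = (1 + t') • (c - b) := by
        have h2 : (t - 1) • (b - a) - (1 + t') • (c - b)
            = (t • (b - a) - (c - d)) - (t' • (c - b) - (a - d)) := by module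
        rw [← sub_eq_zero, h2, ← ht, ← ht']; simp
      have h1' : t - 1 ≠ 0 := sub_ne_zero.2 h1
      have hk2 : b - a = ((t - 1)⁻¹ * (1 + t')) • (c - b) := by
        rw [mul_smul, ← hk, smul_smul, inv_mul_cancel₀ h1', one_smul]
      refine ⟨c - b, ?_⟩
      intro p hp
      simp only [mem_insert_iff, mem_singleton_iff] at hp
      rcases hp with rfl | rfl | rfl
      · exact ⟨0, by simp⟩
      · exact ⟨1, by simp⟩
      · refine ⟨-((t - 1)⁻¹ * (1 + t')), ?_⟩
        rw [neg_smul, ← hk2, vadd_eq_add]; abel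
  -- separation
  obtain ⟨f, u, hfA, hfB⟩ := geometric_hahn_banach_open_open hc1.interior isOpen_interior
    hc2.interior isOpen_interior hdisj
  obtain ⟨y1, hy1⟩ := hi1
  obtain ⟨y2, hy2⟩ := hi2
  have hf : f ≠ 0 := by
    rintro rfl
    have h1 := hfA _ hy1
    have h2 := hfB _ hy2
    simp at h1 h2
    linarith
  have hA : ∀ x ∈ P₁, f x ≤ u := by
    intro x hx
    have h1 : x ∈ closure (interior P₁) := by
      rw [hc1.closure_interior_eq_closure_of_nonempty_interior ⟨y1, hy1⟩]
      exact subset_closure hx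
    exact closure_minimal (fun z hz => (hfA z hz).le) (isClosed_le f.continuous continuous_const) h1
  have hB : ∀ x ∈ P₂, u ≤ f x := by
    intro x hx
    have h1 : x ∈ closure (interior P₂) := by
      rw [hc2.closure_interior_eq_closure_of_nonempty_interior ⟨y2, hy2⟩]
      exact subset_closure hx
    exact closure_minimal (fun z hz => (hfB z hz).le) (isClosed_le continuous_const f.continuous) h1
  have hA' : ∀ x ∈ P₁, -u ≤ (-f) x := fun x hx => by simpa using hA x hx
  have hcv : Convex ℝ (P₁ ∪ P₂) := hunion ▸ hPc
  have hcv' : Convex ℝ (P₂ ∪ P₁) := by rw [union_comm]; exact hcv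
  have hm1 : ∀ x ∈ P, f x = u → x ∈ P₁ := fun x hx hfx =>
    side_mem f hB hcv hcl1 (interior_subset hy1) (hfA _ hy1) (hunion ▸ hx) hfx
  have hm2 : ∀ x ∈ P, f x = u → x ∈ P₂ := fun x hx hfx =>
    side_mem (-f) (u := -u) hA' hcv' hcl2 (interior_subset hy2) (by simpa using hfB _ hy2)
      (by rw [union_comm, hunion]; exact hx) (by simpa using hfx)
  have s1 : P₁ ⊆ P := hunion ▸ subset_union_left
  have s2 : P₂ ⊆ P := hunion ▸ subset_union_right
  have x1 : ∀ v ∈ P₁.extremePoints ℝ, f v < u → v ∈ P.extremePoints ℝ := fun v hv h => by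
    rw [← hunion]; exact side_ext f hB hcv hv h
  have x2 : ∀ v ∈ P₂.extremePoints ℝ, u < f v → v ∈ P.extremePoints ℝ := fun v hv h => by
    rw [← hunion, union_comm]
    exact side_ext (-f) (u := -u) hA' hcv' hv (by simpa using h)
  have y12 : ∀ v ∈ P₁.extremePoints ℝ, f v = u → v ∈ P₂.extremePoints ℝ := fun v hv h =>
    face_ext f hB (fun x hx => hm1 x (s2 hx)) (fun x hx => hm2 x (s1 hx)) hv h
  have y21 : ∀ v ∈ P₂.extremePoints ℝ, f v = u → v ∈ P₁.extremePoints ℝ := fun v hv h =>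
    face_ext (-f) (u := -u) hA' (fun x hx h => hm2 x (s1 hx) (by simpa using h))
      (fun x hx h => hm1 x (s2 hx) (by simpa using h)) hv (by simpa using h)
  -- counting
  set S₁ := F₁.filter (fun x => f x < u) with hS1
  set S₂ := F₂.filter (fun x => u < f x) with hS2
  have c1 : 2 ≤ S₁.card := by
    have h1 : S₁.card + (F₁.filter (fun x => ¬ f x < u)).card = F₁.card := by
      rw [hS1]
      convert Finset.card_filter_add_card_filter_not (s := F₁) (fun x => f x < u)
    have h2 : (F₁.filter (fun x => ¬ f x < u)).card ≤ 2 := card_line (A := P₁) f hf (u := u) (by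
      intro x hx
      rw [Finset.mem_filter] at hx
      have hx1 := (hF1 x).2 hx.1
      exact ⟨hx1, le_antisymm (hA x hx1.1) (not_lt.1 hx.2)⟩)
    omega
  have c2 : 2 ≤ S₂.card := by
    have h1 : S₂.card + (F₂.filter (fun x => ¬ u < f x)).card = F₂.card := by
      rw [hS2]
      convert Finset.card_filter_add_card_filter_not (s := F₂) (fun x => u < f x)
    have h2 : (F₂.filter (fun x => ¬ u < f x)).card ≤ 2 := card_line (A := P₂) f hf (u := u) (by
      intro x hx
      rw [Finset.mem_filter] at hx
      have hx1 := (hF2 x).2 hx.1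
      exact ⟨hx1, le_antisymm (not_lt.1 hx.2) (hB x hx1.1)⟩)
    omega
  have hdj : Disjoint S₁ S₂ := by
    rw [Finset.disjoint_left]
    intro x hx hx'
    rw [Finset.mem_filter] at hx hx'
    linarith [hx.2, hx'.2]
  have hsub : S₁ ∪ S₂ ⊆ F := by
    intro x hx
    rw [Finset.mem_union, Finset.mem_filter, Finset.mem_filter, ← hF1, ← hF2] at hx
    rw [← hF]
    rcases hx with hx | hx
    · exact x1 x hx.1 hx.2
    · exact x2 x hx.1 hx.2
  have hcu : (S₁ ∪ S₂).card = S₁.card + S₂.card := Finset.card_union_of_disjoint hdj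
  have hle := Finset.card_le_card hsub
  have hSF : S₁ ∪ S₂ = F := Finset.eq_of_subset_of_card_le hsub (by omega)
  have c1' : S₁.card = 2 := by omega
  obtain ⟨r, s, hrs, hS2'⟩ := Finset.card_eq_two.1 (show S₂.card = 2 by omega)
  have mS1 : ∀ x, x ∈ S₁ ↔ x ∈ P₁.extremePoints ℝ ∧ f x < u := fun x => by
    rw [hS1, Finset.mem_filter, hF1]
  have mS2 : ∀ x, (x = r ∨ x = s) ↔ x ∈ P₂.extremePoints ℝ ∧ u < f x := fun x => by
    have : x ∈ S₂ ↔ x ∈ P₂.extremePoints ℝ ∧ u < f x := by rw [hS2, Finset.mem_filter, hF2]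
    rw [← this, hS2']; simp
  have mP : ∀ x, x ∈ P.extremePoints ℝ ↔ (x ∈ P₁.extremePoints ℝ ∧ f x < u) ∨ x = r ∨ x = s :=
    fun x => by
      rw [hF, ← hSF, Finset.mem_union, mS1, hS2']; simp
  have mP2 : ∀ x, x ∈ P₂.extremePoints ℝ ↔ (x ∈ P₁.extremePoints ℝ ∧ f x = u) ∨ x = r ∨ x = s := by
    intro x
    rw [mS2]
    constructor
    · intro h
      rcases eq_or_lt_of_le (hB x h.1) with h' | h'
      · exact Or.inl ⟨y21 x h h'.symm, h'.symm⟩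
      · exact Or.inr ⟨h, h'⟩
    · rintro (h | h)
      · exact y12 x h.1 h.2
      · exact h.1
  have fr : u < f r := ((mS2 r).1 (Or.inl rfl)).2
  have fs : u < f s := ((mS2 s).1 (Or.inr rfl)).2
  have fin : ∀ a b c d : ℝ × ℝ, P₁.extremePoints ℝ = {a, b, c, d} → c - d = b - a → c ≠ d →
      f a < u → f b < u → f c = u → f d = u → IsTrapezoid P₂ ∧ IsTrapezoid P := by
    intro a b c d hE hpar hcd fa fb fc fd
    have Ec : c ∈ P₁.extremePoints ℝ := by rw [hE]; simp
    have Ed : d ∈ P₁.extremePoints ℝ := by rw [hE]; simp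
    have eP : P.extremePoints ℝ = {a, b, r, s} := by
      ext x
      rw [mP, hE]
      simp only [mem_insert_iff, mem_singleton_iff]
      constructor
      · rintro (⟨h | h | h | h, h'⟩ | h)
        · exact Or.inl h
        · exact Or.inr (Or.inl h)
        · rw [h] at h'; linarith
        · rw [h] at h'; linarith
        · exact Or.inr (Or.inr h)
      · rintro (h | h | h)
        · subst h; exact Or.inl ⟨Or.inl rfl, fa⟩
        · subst h; exact Or.inl ⟨Or.inr (Or.inl rfl), fb⟩
        · exact Or.inr h
    have eP2 : P₂.extremePoints ℝ = {c, d, r, s} := by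
      ext x
      rw [mP2, hE]
      simp only [mem_insert_iff, mem_singleton_iff]
      constructor
      · rintro (⟨h | h | h | h, h'⟩ | h)
        · rw [h] at h'; linarith
        · rw [h] at h'; linarith
        · exact Or.inl h
        · exact Or.inr (Or.inl h)
        · exact Or.inr (Or.inr h)
      · rintro (h | h | h)
        · subst h; exact Or.inl ⟨Or.inr (Or.inr (Or.inl rfl)), fc⟩
        · subst h; exact Or.inl ⟨Or.inr (Or.inr (Or.inr rfl)), fd⟩
        · exact Or.inr h
    exact fin_trap f hm1 (s1 Ec.1) (s1 Ed.1) (eP ▸ hPh) (hE ▸ hP1h) (eP2 ▸ hP2h) eP eP2 hpar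
      fa fb fc fd fr fs hcd hrs
  have hsum : f c - f d = f b - f a := by rw [← map_sub, hpar, map_sub]
  have no3 : ∀ x y z, x ∈ P₁.extremePoints ℝ → y ∈ P₁.extremePoints ℝ → z ∈ P₁.extremePoints ℝ →
      x ≠ y → y ≠ z → x ≠ z → f x < u → f y < u → f z < u → False := by
    intro x y z hx hy hz h1 h2 h3 gx gy gz
    have : 2 < S₁.card := Finset.two_lt_card.2
      ⟨x, (mS1 x).2 ⟨hx, gx⟩, y, (mS1 y).2 ⟨hy, gy⟩, z, (mS1 z).2 ⟨hz, gz⟩, h1, h3, h2⟩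
    omega
  rcases eq_or_lt_of_le (hA a Ea.1) with fa | fa <;> rcases eq_or_lt_of_le (hA b Eb.1) with fb | fb
  · rcases eq_or_lt_of_le (hA c Ec.1) with fc | fc
    · exact (line_ext f hf Ea Eb Ec fa fb fc n1 n4 n2).elim
    · refine fin c d a b (by rw [hE]; ext; simp; tauto) ?_ n1 fc (by linarith) fa fb
      rw [← neg_sub b a, ← hpar]; abel
  · rcases eq_or_lt_of_le (hA d Ed.1) with fd | fd
    · refine fin b c d a (by rw [hE]; ext; simp; tauto) ?_ n3.symm fb (by linarith) fd fa
      have : d = a + c - b := by rw [eq_sub_iff_add_eq]; linear_combination (exp := 1) -hpar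
      rw [this]; abel
    · rcases eq_or_lt_of_le (hA c Ec.1) with fc | fc
      · linarith
      · exact (no3 b c d Eb Ec Ed n4 n6 n5 fb fc fd).elim
  · rcases eq_or_lt_of_le (hA c Ec.1) with fc | fc
    · refine fin d a b c (by rw [hE]; ext; simp; tauto) ?_ n4 (by linarith) fa fb fc
      have : d = a + c - b := by rw [eq_sub_iff_add_eq]; linear_combination (exp := 1) -hpar
      rw [this]; abel
    · rcases eq_or_lt_of_le (hA d Ed.1) with fd | fd
      · linarith
      · exact (no3 a c d Ea Ec Ed n2 n6 n3 fa fc fd).elim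
  · rcases eq_or_lt_of_le (hA c Ec.1) with fc | fc
    · rcases eq_or_lt_of_le (hA d Ed.1) with fd | fd
      · exact fin a b c d hE hpar n6 fa fb fc fd
      · exact (no3 a b d Ea Eb Ed n1 n5 n3 fa fb fd).elim
    · exact (no3 a b c Ea Eb Ec n1 n4 n2 fa fb fc).elim
end

section
/- For every real number α with 0 < α < 1, there exists a unique real number β with α < β < 1 such that (α − α²)β³ + (1 − 2α + 2α²)β² + (−1 + 2α − 4α² + α³)β + α² = 0. Consequently, the set {(α, β) : 0 < α < β < 1 and (α − α²)β³ + (1 − 2α + 2α²)β² + (−1 + 2α − 4α² + α³)β + α² = 0} is the graph of a function β : (0,1) → (0,1) with α < β(α) < 1 for all α ∈ (0,1). -/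
open Set

lemma family_IV_aux (α x y : ℝ) (hα : 0 < α) (hα' : α < 1) (hx : α < x) (hxy : x < y)
    (fx : (α - α ^ 2) * x ^ 3 + (1 - 2 * α + 2 * α ^ 2) * x ^ 2 +
        (-1 + 2 * α - 4 * α ^ 2 + α ^ 3) * x + α ^ 2 = 0)
    (fy : (α - α ^ 2) * y ^ 3 + (1 - 2 * α + 2 * α ^ 2) * y ^ 2 +
        (-1 + 2 * α - 4 * α ^ 2 + α ^ 3) * y + α ^ 2 = 0) : False := by
  have ha : 0 < α - α ^ 2 := by nlinarith
  have hb : 0 < 1 - 2 * α + 2 * α ^ 2 := by nlinarith [sq_nonneg (1 - α)]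
  have h1 : 0 < (y - x) * (x - α) * (y - α) *
      ((α - α ^ 2) * (x + y + α) + (1 - 2 * α + 2 * α ^ 2)) := by
    have := sub_pos.2 hxy
    have := sub_pos.2 hx
    have := sub_pos.2 (hx.trans hxy)
    have : 0 < x + y + α := by linarith
    positivity
  have h2 : 0 < α * (1 - α) ^ 4 * (y - x) := by
    have := sub_pos.2 hxy
    have := sub_pos.2 hα'
    positivity
  have h3 : (y - x) * (x - α) * (y - α) *
      ((α - α ^ 2) * (x + y + α) + (1 - 2 * α + 2 * α ^ 2)) = -(α * (1 - α) ^ 4 * (y - x)) := by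
    linear_combination (x - α) * fy - (y - α) * fx
  linarith

/-- Family (IV): for every `0 < α < 1` there is a unique `β` with `α < β < 1` and
`(α − α²)β³ + (1 − 2α + 2α²)β² + (−1 + 2α − 4α² + α³)β + α² = 0`; hence the solution
set is the graph of a function `β : (0,1) → (0,1)` with `α < β(α) < 1`. -/
theorem family_IV (α : ℝ) (hα : 0 < α) (hα' : α < 1) :
    ∃! β : ℝ, α < β ∧ β < 1 ∧
      (α - α ^ 2) * β ^ 3 + (1 - 2 * α + 2 * α ^ 2) * β ^ 2 +
        (-1 + 2 * α - 4 * α ^ 2 + α ^ 3) * β + α ^ 2 = 0 := by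
  have h1 := sub_pos.2 hα'
  have hc : ContinuousOn (fun β : ℝ => (α - α ^ 2) * β ^ 3 + (1 - 2 * α + 2 * α ^ 2) * β ^ 2 +
        (-1 + 2 * α - 4 * α ^ 2 + α ^ 3) * β + α ^ 2) (Icc α 1) := by fun_prop
  have hm := intermediate_value_Ioo hα'.le hc
  have h0 : (0 : ℝ) ∈ Ioo ((α - α ^ 2) * α ^ 3 + (1 - 2 * α + 2 * α ^ 2) * α ^ 2 +
        (-1 + 2 * α - 4 * α ^ 2 + α ^ 3) * α + α ^ 2)
      ((α - α ^ 2) * 1 ^ 3 + (1 - 2 * α + 2 * α ^ 2) * 1 ^ 2 +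
        (-1 + 2 * α - 4 * α ^ 2 + α ^ 3) * 1 + α ^ 2) := by
    have p : 0 < α * (1 - α) ^ 4 := by positivity
    have q : 0 < α * (1 - α) ^ 2 := by positivity
    constructor
    · linear_combination p
    · linear_combination q
  obtain ⟨β, ⟨hb1, hb2⟩, hb⟩ := hm h0
  refine ⟨β, ⟨hb1, hb2, hb⟩, ?_⟩
  rintro y ⟨hy1, hy2, hy⟩
  rcases lt_trichotomy y β with h | h | h
  · exact (family_IV_aux α y β hα hα' hy1 h hy hb).elim
  · exact h
  · exact (family_IV_aux α β y hα hα' hb1 h hb hy).elim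
end
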